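/- arXiv:1605.06912 — 4 statements merged into one kernel-verified Lean document; each statement's English description precedes it below -/
import Mathlib

section
/- Let 0 < α < 1, x > 0, and let y be three times continuously differentiable on [0, x] with M₃ = max_{0 ≤ t ≤ x} |y'''(t)|. Then for every integer n ≥ 2, with h = x/n, the difference between the weighted sum of exact first derivatives and its central-difference version satisfies | h^{1−α} Σ_{k=1}^{n−1} y'(x−kh)/k^α − (1/(2h^α)) Σ_{k=1}^{n−1} ( y(x−(k−1)h) − y(x−(k+1)h) )/k^α | ≤ ( M₃ x^{1−α} / (6(1−α)) ) h². -/
theorem sum_inv_rpow_le {α : ℝ} (hα0 : 0 < α) (hα1 : α < 1) (m : ℕ) :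
    ∑ k ∈ Finset.Icc 1 m, ((k : ℝ) ^ α)⁻¹ ≤ (m : ℝ) ^ (1 - α) / (1 - α) := by
  have h1 : 0 < 1 - α := by linarith
  induction m with
  | zero => simp [Real.zero_rpow h1.ne']
  | succ m ih =>
    rw [Finset.sum_Icc_succ_top (by omega)]
    have hpos : (0 : ℝ) < (m : ℝ) + 1 := by positivity
    have hinv : 1 / ((m : ℝ) + 1) ≤ 1 := by
      rw [div_le_one hpos]; linarith [(Nat.cast_nonneg m : (0 : ℝ) ≤ m)]
    have hb := rpow_one_add_le_one_add_mul_self (s := -(1 / ((m : ℝ) + 1)))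
      (by linarith) h1.le (by linarith : 1 - α ≤ 1)
    have hm : (m : ℝ) = ((m : ℝ) + 1) * (1 + -(1 / ((m : ℝ) + 1))) := by field_simp; ring
    have hmul : (m : ℝ) ^ (1 - α)
        = ((m : ℝ) + 1) ^ (1 - α) * (1 + -(1 / ((m : ℝ) + 1))) ^ (1 - α) := by
      rw [← Real.mul_rpow hpos.le (by linarith), ← hm]
    have hsplit : ((m : ℝ) + 1) ^ (1 - α) = ((m : ℝ) + 1) * (((m : ℝ) + 1) ^ α)⁻¹ := by
      rw [Real.rpow_sub hpos, Real.rpow_one, div_eq_mul_inv]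
    have hstep : (m : ℝ) ^ (1 - α)
        ≤ ((m : ℝ) + 1) ^ (1 - α) - (1 - α) * (((m : ℝ) + 1) ^ α)⁻¹ := by
      rw [hmul]
      refine (mul_le_mul_of_nonneg_left hb (by positivity)).trans_eq ?_
      rw [hsplit]
      field_simp
      ring
    push_cast
    rw [le_div_iff₀ h1] at ih ⊢
    linarith

theorem abs_central_difference_sub_le {y : ℝ → ℝ} (hy : ContDiff ℝ 3 y) {c h M : ℝ}
    (hh : 0 ≤ h) (hM : ∀ t ∈ Set.Icc (c - h) (c + h), |iteratedDeriv 3 y t| ≤ M) :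
    |2 * h * deriv y c - (y (c + h) - y (c - h))| ≤ M * h ^ 3 / 3 := by
  have d (k : ℕ) (hk : k < 3) (t : ℝ) :
      HasDerivAt (iteratedDeriv k y) (iteratedDeriv (k + 1) y t) t := by
    rw [iteratedDeriv_succ]
    exact (hy.differentiable_iteratedDeriv k (by exact_mod_cast hk) t).hasDerivAt
  have dp (k : ℕ) (hk : k < 3) (t : ℝ) :
      HasDerivAt (fun s => iteratedDeriv k y (c + s)) (iteratedDeriv (k + 1) y (c + t)) t :=
    (d k hk (c + t)).comp_const_add c t
  have dm (k : ℕ) (hk : k < 3) (t : ℝ) :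
      HasDerivAt (fun s => iteratedDeriv k y (c - s)) (-iteratedDeriv (k + 1) y (c - t)) t :=
    (d k hk (c - t)).comp_const_sub c t
  have bound {f f' B B' : ℝ → ℝ} (hf : ∀ t, HasDerivAt f (f' t) t)
      (hB : ∀ t, HasDerivAt B (B' t) t) (hf0 : f 0 = 0) (hB0 : B 0 = 0)
      (hle : ∀ t ∈ Set.Icc 0 h, |f' t| ≤ B' t) : ∀ t ∈ Set.Icc 0 h, |f t| ≤ B t := by
    intro t ht
    exact image_norm_le_of_norm_deriv_right_le_deriv_boundary
      (fun s _ => (hf s).continuousAt.continuousWithinAt)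
      (fun s _ => (hf s).hasDerivWithinAt) (by simp [hf0, hB0]) hB
      (fun s hs => hle s ⟨hs.1, hs.2.le⟩) ht
  have second := bound (B := fun t => 2 * M * t) (B' := fun _ => 2 * M)
    (fun t => (dp 2 (by norm_num) t).sub (dm 2 (by norm_num) t))
    (fun t => by simpa using (hasDerivAt_id t).const_mul (2 * M)) (by simp) (by simp)
    (fun t ht => by
      have hp := abs_le.1 (hM (c + t) ⟨by linarith [ht.1], by linarith [ht.2]⟩)
      have hm := abs_le.1 (hM (c - t) ⟨by linarith [ht.2], by linarith [ht.1]⟩)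
      norm_num
      exact abs_le.2 ⟨by linarith, by linarith⟩)
  have first := bound (B := fun t => M * t ^ 2) (B' := fun t => 2 * M * t)
    (fun t => ((dp 1 (by norm_num) t).add (dm 1 (by norm_num) t)).sub_const
      (2 * iteratedDeriv 1 y c))
    (fun t => by
      refine (((hasDerivAt_id' t).pow 2).const_mul M).congr_deriv ?_
      norm_num; ring) (by simp; ring) (by simp)
    (fun t ht => by simpa [sub_eq_add_neg] using second t ht)
  have zeroth := bound (B := fun t => M * t ^ 3 / 3) (B' := fun t => M * t ^ 2)
    (fun t => ((dp 0 (by norm_num) t).sub (dm 0 (by norm_num) t)).sub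
      ((hasDerivAt_id t).mul_const (2 * iteratedDeriv 1 y c)))
    (fun t => by
      refine ((((hasDerivAt_id' t).pow 3).const_mul M).div_const 3).congr_deriv ?_
      norm_num; ring) (by simp) (by simp)
    (fun t ht => by simpa [sub_eq_add_neg] using first t ht)
  have := zeroth h ⟨hh, le_rfl⟩
  rw [abs_sub_comm]
  convert this using 2
  simp [iteratedDeriv_one]
  ring

theorem caputo_central_difference_error
    (α x M₃ : ℝ) (hα0 : 0 < α) (hα1 : α < 1) (hx : 0 < x)
    (y : ℝ → ℝ) (hy : ContDiff ℝ 3 y)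
    (hM : ∀ t ∈ Set.Icc (0:ℝ) x, |iteratedDeriv 3 y t| ≤ M₃) :
    ∀ n : ℕ, 2 ≤ n →
      |(x / n) ^ (1 - α) *
          ∑ k ∈ Finset.Icc 1 (n - 1), deriv y (x - (k:ℝ) * (x / n)) / (k:ℝ) ^ α
        - (1 / (2 * (x / n) ^ α)) *
          ∑ k ∈ Finset.Icc 1 (n - 1),
            (y (x - ((k:ℝ) - 1) * (x / n)) - y (x - ((k:ℝ) + 1) * (x / n))) / (k:ℝ) ^ α|
      ≤ M₃ * x ^ (1 - α) / (6 * (1 - α)) * (x / n) ^ 2 := by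
  intro n hn
  have hn0 : (0 : ℝ) < n := by exact_mod_cast (by omega : 0 < n)
  have h1 : 0 < 1 - α := by linarith
  have hM0 : 0 ≤ M₃ := (abs_nonneg _).trans (hM 0 ⟨le_rfl, hx.le⟩)
  have hxn : x = n * (x / n) := by field_simp
  have hxpow : x ^ (1 - α) = (n : ℝ) ^ (1 - α) * (x / n) ^ (1 - α) := by
    rw [← Real.mul_rpow hn0.le (by positivity), ← hxn]
  set h := x / n with hdef
  have hh : 0 < h := by positivity
  have hpow : h ^ (1 - α) = h / h ^ α := by rw [Real.rpow_sub hh, Real.rpow_one]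
  have hhα : 0 < h ^ α := by positivity
  rw [Finset.mul_sum, Finset.mul_sum, ← Finset.sum_sub_distrib]
  have hterm : ∀ k ∈ Finset.Icc 1 (n - 1),
      |h ^ (1 - α) * (deriv y (x - (k:ℝ) * h) / (k:ℝ) ^ α)
        - 1 / (2 * h ^ α) * ((y (x - ((k:ℝ) - 1) * h) - y (x - ((k:ℝ) + 1) * h)) / (k:ℝ) ^ α)|
      ≤ M₃ * h ^ 2 * h ^ (1 - α) / 6 * ((k : ℝ) ^ α)⁻¹ := by
    intro k hk
    obtain ⟨hk1, hk2⟩ := Finset.mem_Icc.1 hk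
    have hk1' : (1 : ℝ) ≤ k := by exact_mod_cast hk1
    have hk2' : (k : ℝ) + 1 ≤ n := by exact_mod_cast (by omega : k + 1 ≤ n)
    have hkα : 0 < (k : ℝ) ^ α := by positivity
    have hc := abs_central_difference_sub_le hy (c := x - k * h) hh.le (M := M₃)
      (fun t ht => hM t ⟨by nlinarith [ht.1], by nlinarith [ht.2]⟩)
    rw [show x - k * h + h = x - ((k:ℝ) - 1) * h by ring,
      show x - k * h - h = x - ((k:ℝ) + 1) * h by ring] at hc
    have hfactor : ∀ a b : ℝ, h ^ (1 - α) * (a / (k:ℝ) ^ α) - 1 / (2 * h ^ α) * (b / (k:ℝ) ^ α)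
        = 1 / (2 * h ^ α) * ((k : ℝ) ^ α)⁻¹ * (2 * h * a - b) := by
      intro a b
      rw [hpow]
      field_simp
    rw [hfactor, abs_mul, abs_of_pos (by positivity)]
    refine (mul_le_mul_of_nonneg_left hc (by positivity)).trans_eq ?_
    rw [hpow]
    field_simp
    ring
  refine (Finset.abs_sum_le_sum_abs _ _).trans ((Finset.sum_le_sum hterm).trans ?_)
  rw [← Finset.mul_sum]
  have hsum : ∑ k ∈ Finset.Icc 1 (n - 1), ((k : ℝ) ^ α)⁻¹ ≤ (n : ℝ) ^ (1 - α) / (1 - α) := by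
    refine (sum_inv_rpow_le hα0 hα1 (n - 1)).trans ?_
    gcongr
    exact Nat.sub_le n 1
  refine (mul_le_mul_of_nonneg_left hsum (by positivity)).trans_eq ?_
  rw [hxpow]
  field_simp
end

section
/- Let 0 < α < 1, x > 0, and let y be smooth (C^∞) on [0, x] with y(0) = y'(0) = 0. Define the weights ω₀ = 1, ω₁ = 2^{−α}, ω_k = (k+1)^{−α} − (k−1)^{−α} for 2 ≤ k ≤ n−2, ω_{n−1} = −(n−2)^{−α}, ω_n = −(n−1)^{−α}. Then there exists a constant C > 0 (independent of n) such that for all integers n ≥ 4, with h = x/n, | (1/(2Γ(1−α)h^α)) Σ_{k=0}^{n} ω_k y(x−kh) − D^α y(x) − (ζ(α)/Γ(1−α)) y'(x) h^{1−α} + (ζ(α−1)/Γ(1−α)) y''(x) h^{2−α} | ≤ C h². -/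
/-- Real values of the Riemann zeta function at real arguments
(real part of the analytic continuation). -/
noncomputable def zr (s : ℝ) : ℝ := (riemannZeta s).re

/-- The Caputo derivative of order `α` of `y` at `x`. -/
noncomputable def caputo (α : ℝ) (y : ℝ → ℝ) (x : ℝ) : ℝ :=
  (1 / Real.Gamma (1 - α)) * ∫ t in (0:ℝ)..x, deriv y t / (x - t) ^ α


open Filter Topology

/-- Error of the trapezoidal rule on a single cell, for a vector-valued integrand `f` with
antiderivative `F`. -/
lemma norm_trapezoid_error_le {E : Type*} [NormedAddCommGroup E] [NormedSpace ℝ E]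
    {F f f' f'' : ℝ → E} {a b M : ℝ} (hab : a ≤ b)
    (hF : ∀ t ∈ Set.Icc a b, HasDerivAt F (f t) t)
    (hf : ∀ t ∈ Set.Icc a b, HasDerivAt f (f' t) t)
    (hf' : ∀ t ∈ Set.Icc a b, HasDerivAt f' (f'' t) t)
    (hM : ∀ t ∈ Set.Icc a b, ‖f'' t‖ ≤ M) :
    ‖F b - F a - ((b - a) / 2) • (f a + f b)‖ ≤ M * (b - a) ^ 3 := by
  have haI : a ∈ Set.Icc a b := ⟨le_rfl, hab⟩
  have hbI : b ∈ Set.Icc a b := ⟨hab, le_rfl⟩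
  have hM0 : 0 ≤ M := (norm_nonneg _).trans (hM a haI)
  have h1 : ∀ u ∈ Set.Icc a b, ∀ t ∈ Set.Icc a b, ‖f' u - f' t‖ ≤ M * (b - a) := by
    intro u hu t ht
    refine (Convex.norm_image_sub_le_of_norm_hasDerivWithin_le
      (fun s hs => (hf' s hs).hasDerivWithinAt) hM (convex_Icc a b) ht hu).trans ?_
    gcongr
    rw [Real.norm_eq_abs, abs_le]
    constructor <;> linarith [hu.1, hu.2, ht.1, ht.2]
  have h2 : ∀ t ∈ Set.Icc a b, ‖f t - f a - (t - a) • f' t‖ ≤ M * (b - a) * (b - a) := by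
    intro t ht
    have hd : ∀ s ∈ Set.Icc a b,
        HasDerivWithinAt (fun s => f s - s • f' t) (f' s - (1 : ℝ) • f' t) (Set.Icc a b) s :=
      fun s hs => ((hf s hs).sub ((hasDerivAt_id s).smul_const (f' t))).hasDerivWithinAt
    have := Convex.norm_image_sub_le_of_norm_hasDerivWithin_le hd
      (fun s hs => by simpa using h1 s hs t ht) (convex_Icc a b) haI ht
    have e : f t - f a - (t - a) • f' t = f t - t • f' t - (f a - a • f' t) := by module
    rw [e]
    refine this.trans ?_
    have hM1 : 0 ≤ M * (b - a) := mul_nonneg hM0 (by linarith)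
    gcongr
    rw [Real.norm_eq_abs, abs_le]
    constructor <;> linarith [ht.1, ht.2]
  have hd : ∀ t ∈ Set.Icc a b,
      HasDerivWithinAt (fun t => F t - ((t - a) / 2) • (f a + f t))
        (f t - (((t - a) / 2) • f' t + (1 / 2 : ℝ) • (f a + f t))) (Set.Icc a b) t := by
    intro t ht
    have h3 : HasDerivAt (fun t : ℝ => (t - a) / 2) (1 / 2) t :=
      ((hasDerivAt_id t).sub_const a).div_const 2
    exact ((hF t ht).sub (h3.smul ((hf t ht).const_add (f a)))).hasDerivWithinAt
  have h4 := Convex.norm_image_sub_le_of_norm_hasDerivWithin_le (C := M * (b - a) * (b - a)) hd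
    (fun t ht => by
      have e : f t - (((t - a) / 2) • f' t + (1 / 2 : ℝ) • (f a + f t)) =
          (1 / 2 : ℝ) • (f t - f a - (t - a) • f' t) := by module
      rw [e, norm_smul]
      have := h2 t ht
      have h5 : ‖(1 / 2 : ℝ)‖ = 1 / 2 := by norm_num
      rw [h5]
      have := norm_nonneg (f t - f a - (t - a) • f' t)
      linarith) (convex_Icc a b) haI hbI
  have e : F b - F a - ((b - a) / 2) • (f a + f b) =
      F b - ((b - a) / 2) • (f a + f b) - (F a - ((a - a) / 2) • (f a + f a)) := by module
  rw [e]
  refine h4.trans (le_of_eq ?_)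
  rw [Real.norm_eq_abs, abs_of_nonneg (by linarith)]
  ring

/-- The trapezoidal error of `(1 - s) t ^ (-s)` on `[k + 1, k + 2]`. -/
noncomputable def cpowTrapezoid (k : ℕ) (s : ℂ) : ℂ :=
  ((k : ℂ) + 2) ^ (1 - s) - ((k : ℂ) + 1) ^ (1 - s)
    - (1 / 2) * ((1 - s) * ((k : ℂ) + 1) ^ (-s) + (1 - s) * ((k : ℂ) + 2) ^ (-s))

lemma hasDerivAt_ofReal_cpow {t : ℝ} (ht : 0 < t) (s : ℂ) :
    HasDerivAt (fun u : ℝ => (u : ℂ) ^ s) (s * (t : ℂ) ^ (s - 1)) t := by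
  simpa using ((hasDerivAt_id (t : ℂ)).cpow_const (c := s) (Or.inl (by simpa using ht))).comp_ofReal

lemma norm_cpowTrapezoid_le (k : ℕ) {s : ℂ} {c : ℝ} (hc : -1 < c) (hcs : c ≤ s.re) :
    ‖cpowTrapezoid k s‖ ≤ ‖(1 - s) * s * (s + 1)‖ * ((k : ℝ) + 1) ^ (-c - 2) := by
  have hpos : ∀ t ∈ Set.Icc ((k : ℝ) + 1) (k + 2), 0 < t := fun t ht =>
    lt_of_lt_of_le (by positivity) ht.1
  have h := norm_trapezoid_error_le (a := (k : ℝ) + 1) (b := k + 2)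
    (M := ‖(1 - s) * s * (s + 1)‖ * ((k : ℝ) + 1) ^ (-c - 2))
    (F := fun u : ℝ => (u : ℂ) ^ (1 - s)) (f := fun u : ℝ => (1 - s) * (u : ℂ) ^ (-s))
    (f' := fun u : ℝ => (1 - s) * (-s * (u : ℂ) ^ (-s - 1)))
    (f'' := fun u : ℝ => (1 - s) * (-s * ((-s - 1) * (u : ℂ) ^ (-s - 1 - 1)))) (by linarith)
    (fun t ht => by
      have := hasDerivAt_ofReal_cpow (hpos t ht) (1 - s)
      rwa [show 1 - s - 1 = -s by ring] at this)
    (fun t ht => (hasDerivAt_ofReal_cpow (hpos t ht) (-s)).const_mul _)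
    (fun t ht => ((hasDerivAt_ofReal_cpow (hpos t ht) (-s - 1)).const_mul _).const_mul _)
    (fun t ht => by
      have e : (1 - s) * (-s * ((-s - 1) * (t : ℂ) ^ (-s - 1 - 1))) =
        ((1 - s) * s * (s + 1)) * (t : ℂ) ^ (-s - 1 - 1) := by ring
      rw [e, norm_mul, Complex.norm_cpow_eq_rpow_re_of_pos (hpos t ht)]
      gcongr
      have hk : (1 : ℝ) ≤ (k : ℝ) + 1 := by linarith [k.cast_nonneg (α := ℝ)]
      calc t ^ (-s - 1 - 1).re ≤ t ^ (-c - 2) := by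
            apply Real.rpow_le_rpow_of_exponent_le (hk.trans ht.1)
            simp; linarith
        _ ≤ _ := Real.rpow_le_rpow_of_nonpos (by positivity) ht.1 (by linarith))
  have e2 : (k : ℝ) + 2 - (k + 1) = 1 := by ring
  rw [e2] at h
  rw [one_pow, mul_one] at h
  refine (congrArg norm ?_).trans_le h
  simp only [cpowTrapezoid, Complex.real_smul]
  push_cast
  ring

lemma sum_cpowTrapezoid (s : ℂ) (n : ℕ) :
    ∑ k ∈ Finset.range n, cpowTrapezoid k s =
      ((n : ℂ) + 1) ^ (1 - s) - 1 - (1 - s) *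
        (∑ k ∈ Finset.range n, ((k : ℂ) + 1) ^ (-s) + (1 / 2) * ((n : ℂ) + 1) ^ (-s) - 1 / 2) := by
  induction n with
  | zero => simp
  | succ n ih =>
    rw [Finset.sum_range_succ, Finset.sum_range_succ, ih, cpowTrapezoid]
    push_cast
    have : (n : ℂ) + 1 + 1 = n + 2 := by ring
    rw [this]
    ring

lemma summable_nat_add_one_rpow {p : ℝ} (hp : p < -1) :
    Summable fun k : ℕ => ((k : ℝ) + 1) ^ p := by
  have := (summable_nat_add_iff 1).2 (Real.summable_nat_rpow.2 hp)
  simpa using this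

lemma summable_cpowTrapezoid {s : ℂ} (hs : -1 < s.re) : Summable fun k => cpowTrapezoid k s :=
  Summable.of_norm_bounded ((summable_nat_add_one_rpow (by linarith)).mul_left _)
    (fun k => norm_cpowTrapezoid_le k hs le_rfl)

lemma tsum_cpowTrapezoid_of_one_lt {s : ℂ} (hs : 1 < s.re) :
    ∑' k, cpowTrapezoid k s = riemannZeta₁ s - 1 + (1 - s) / 2 := by
  have hs1 : s ≠ 1 := by rintro rfl; simp at hs
  have h1 := (summable_cpowTrapezoid (s := s) (by linarith)).hasSum.tendsto_sum_nat
  have hz : Tendsto (fun n : ℕ => ∑ k ∈ Finset.range n, ((k : ℂ) + 1) ^ (-s)) atTop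
      (𝓝 (riemannZeta s)) := by
    have hsum : Summable fun k : ℕ => 1 / ((k : ℂ) + 1) ^ s := by
      have := (summable_nat_add_iff 1).2 (Complex.summable_one_div_nat_cpow.2 hs)
      simpa using this
    rw [zeta_eq_tsum_one_div_nat_add_one_cpow hs]
    refine hsum.hasSum.tendsto_sum_nat.congr fun n => Finset.sum_congr rfl fun k _ => ?_
    rw [Complex.cpow_neg, one_div]
  have h0 : ∀ w : ℂ, w.re < 0 → Tendsto (fun n : ℕ => ((n : ℂ) + 1) ^ w) atTop (𝓝 0) := by
    intro w hw
    rw [tendsto_zero_iff_norm_tendsto_zero]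
    have h2 : Tendsto (fun n : ℕ => ((n : ℝ) + 1) ^ (-(-w.re))) atTop (𝓝 0) :=
      (tendsto_rpow_neg_atTop (by linarith)).comp
        (tendsto_atTop_add_const_right _ _ tendsto_natCast_atTop_atTop)
    refine h2.congr fun n => ?_
    have := Complex.norm_cpow_eq_rpow_re_of_pos (x := (n : ℝ) + 1) (by positivity) w
    push_cast at this
    rw [this, neg_neg]
  have h3 := (((h0 (1 - s) (by simpa using hs)).sub_const 1).sub
    (((hz.add ((h0 (-s) (by simp; linarith)).const_mul (1 / 2))).sub_const (1 / 2)).const_mul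
      (1 - s)))
  have h4 := tendsto_nhds_unique h1 (h3.congr fun n => (sum_cpowTrapezoid s n).symm)
  rw [h4, riemannZeta_eq_inv_sub_mul hs1]
  have : s - 1 ≠ 0 := sub_ne_zero.2 hs1
  field_simp
  ring

lemma differentiable_cpowTrapezoid (k : ℕ) : Differentiable ℂ (cpowTrapezoid k) := by
  have h1 : (k : ℂ) + 1 ≠ 0 := by exact_mod_cast k.succ_ne_zero
  have h2 : (k : ℂ) + 2 ≠ 0 := by exact_mod_cast (k + 1).succ_ne_zero
  have hc : ∀ a : ℂ, a ≠ 0 → ∀ g : ℂ → ℂ, Differentiable ℂ g →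
      Differentiable ℂ fun s => a ^ g s := fun a ha g hg s => (hg s).const_cpow (Or.inl ha)
  have e1 := hc _ h1 (fun s => 1 - s) (by fun_prop)
  have e2 := hc _ h2 (fun s => 1 - s) (by fun_prop)
  have e3 := hc _ h1 (fun s => -s) (by fun_prop)
  have e4 := hc _ h2 (fun s => -s) (by fun_prop)
  unfold cpowTrapezoid
  fun_prop

/-- First-order Euler-Maclaurin formula for the Riemann zeta function, on `-1 < re s`. -/
lemma tsum_cpowTrapezoid {s : ℂ} (hs : -1 < s.re) :
    ∑' k, cpowTrapezoid k s = riemannZeta₁ s - 1 + (1 - s) / 2 := by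
  obtain ⟨c, hc1, hcs, hc2⟩ : ∃ c, -1 < c ∧ c < s.re ∧ c < 2 := by
    obtain ⟨c, h1, h2⟩ := exists_between (show -1 < min s.re 2 from lt_min hs (by norm_num))
    exact ⟨c, h1, h2.trans_le (min_le_left _ _), h2.trans_le (min_le_right _ _)⟩
  set R : ℝ := ‖s‖ + 3
  set U : Set ℂ := {w | c < w.re} ∩ Metric.ball 0 R
  have hUo : IsOpen U := (isOpen_lt continuous_const Complex.continuous_re).inter Metric.isOpen_ball
  have hUc : Convex ℝ U := (convex_halfSpace_re_gt c).inter (convex_ball _ _)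
  have hsU : s ∈ U := ⟨hcs, by simp [R]⟩
  have h2U : (2 : ℂ) ∈ U := ⟨by simpa using hc2, by
    simp only [Metric.mem_ball, dist_zero_right, R]
    norm_num
    linarith [norm_nonneg s]⟩
  have hsum : Summable fun k : ℕ => ((1 + R) * R * (R + 1)) * ((k : ℝ) + 1) ^ (-c - 2) :=
    (summable_nat_add_one_rpow (by linarith)).mul_left _
  have hd : DifferentiableOn ℂ (fun w => ∑' k, cpowTrapezoid k w) U := by
    refine Complex.differentiableOn_tsum_of_summable_norm hsum
      (fun k => (differentiable_cpowTrapezoid k).differentiableOn) hUo fun k w hw => ?_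
    refine (norm_cpowTrapezoid_le k hc1 (le_of_lt hw.1)).trans ?_
    have hwR : ‖w‖ ≤ R := le_of_lt (by simpa using hw.2)
    have i1 : ‖1 - w‖ ≤ 1 + R := (norm_sub_le _ _).trans (by simpa using hwR)
    have i2 : ‖w + 1‖ ≤ R + 1 := (norm_add_le _ _).trans (by simpa using hwR)
    rw [norm_mul, norm_mul]
    gcongr
  have hz : Differentiable ℂ fun w => riemannZeta₁ w - 1 + (1 - w) / 2 := by
    have := differentiable_riemannZeta₁
    fun_prop
  refine (hd.analyticOnNhd hUo).eqOn_of_preconnected_of_eventuallyEq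
    (hz.differentiableOn.analyticOnNhd hUo) hUc.isPreconnected h2U ?_ hsU
  have : {w : ℂ | 1 < w.re} ∈ 𝓝 (2 : ℂ) :=
    (isOpen_lt continuous_const Complex.continuous_re).mem_nhds (by simp)
  filter_upwards [this] with w hw using tsum_cpowTrapezoid_of_one_lt hw

/-- A convergent sequence with increments `O(n ^ (-p - 1))` has error `O(n ^ (-p))`. -/
lemma abs_sub_le_of_increment_le {a : ℕ → ℝ} {L K p : ℝ} (hp : 0 < p)
    (ha : Tendsto a atTop (𝓝 L))
    (h : ∀ n, |a (n + 1) - a n| ≤ K * ((n : ℝ) + 1) ^ (-p - 1)) (n : ℕ) :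
    |a n - L| ≤ K * 2 ^ (p + 1) / p * ((n : ℝ) + 1) ^ (-p) := by
  set D := K * 2 ^ (p + 1) / p
  have hK : 0 ≤ K := by simpa using (abs_nonneg _).trans (h 0)
  have hstep : ∀ n : ℕ, K * ((n : ℝ) + 1) ^ (-p - 1) ≤
      D * ((n : ℝ) + 1) ^ (-p) - D * ((n : ℝ) + 1 + 1) ^ (-p) := by
    intro n
    have hn : (0 : ℝ) < (n : ℝ) + 1 := by positivity
    have hmv : ((n : ℝ) + 1 + 1) ^ (-p) - ((n : ℝ) + 1) ^ (-p) ≤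
        (-p * ((n : ℝ) + 1 + 1) ^ (-p - 1)) * ((n + 1 + 1) - (n + 1)) := by
      refine Convex.image_sub_le_mul_sub_of_deriv_le (D := Set.Icc ((n : ℝ) + 1) (n + 1 + 1))
        (f := fun t => t ^ (-p)) (convex_Icc _ _) ?_ ?_ ?_ _ (by simp) _ (by simp) (by simp)
      · exact fun t ht => (Real.continuousAt_rpow_const _ _
          (Or.inl (hn.trans_le ht.1).ne')).continuousWithinAt
      · rw [interior_Icc]
        exact fun t ht => (Real.hasDerivAt_rpow_const
          (Or.inl (hn.trans ht.1).ne')).differentiableAt.differentiableWithinAt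
      · rw [interior_Icc]
        intro t ht
        rw [(Real.hasDerivAt_rpow_const (Or.inl (hn.trans ht.1).ne')).deriv]
        have := Real.rpow_le_rpow_of_nonpos (hn.trans ht.1) ht.2.le (show -p - 1 ≤ 0 by linarith)
        nlinarith
    have h2 : (2 * ((n : ℝ) + 1)) ^ (-p - 1) ≤ ((n : ℝ) + 1 + 1) ^ (-p - 1) :=
      Real.rpow_le_rpow_of_nonpos (by positivity) (by linarith [n.cast_nonneg (α := ℝ)])
        (by linarith)
    rw [Real.mul_rpow (by norm_num) hn.le] at h2
    have h3 : (2 : ℝ) ^ (p + 1) * 2 ^ (-p - 1) = 1 := by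
      rw [← Real.rpow_add (by norm_num)]; simp
    have h4 : K * ((n : ℝ) + 1) ^ (-p - 1) = D * (p * (2 ^ (-p - 1) * ((n : ℝ) + 1) ^ (-p - 1))) := by
      simp only [D]
      field_simp
      linear_combination (-K) * h3
    rw [h4, ← mul_sub]
    have hD : 0 ≤ D := by positivity
    gcongr
    nlinarith
  have hlim : Tendsto (fun n : ℕ => D * ((n : ℝ) + 1) ^ (-p)) atTop (𝓝 0) := by
    simpa using ((tendsto_rpow_neg_atTop hp).comp
        (tendsto_atTop_add_const_right _ (1 : ℝ) tendsto_natCast_atTop_atTop)).const_mul D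
  have hu : Antitone fun n : ℕ => a n + D * ((n : ℝ) + 1) ^ (-p) := by
    refine antitone_nat_of_succ_le fun n => ?_
    have := (abs_le.1 (h n)).2
    have := hstep n
    push_cast
    linarith
  have hl : Monotone fun n : ℕ => a n - D * ((n : ℝ) + 1) ^ (-p) := by
    refine monotone_nat_of_le_succ fun n => ?_
    have := (abs_le.1 (h n)).1
    have := hstep n
    push_cast
    linarith
  have i1 := hu.le_of_tendsto (ha.add hlim) n
  have i2 := hl.ge_of_tendsto (ha.sub hlim) n
  rw [abs_le]
  constructor <;> linarith

/-- Euler-Maclaurin expansion of the partial sums of `k ^ (-σ)`, for `-1 < σ < 1`. -/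
lemma exists_abs_sum_rpow_sub_le {σ : ℝ} (h1 : -1 < σ) (h2 : σ < 1) :
    ∃ C, ∀ n : ℕ, |∑ k ∈ Finset.range n, ((k : ℝ) + 1) ^ (-σ) - zr σ
      - ((n : ℝ) + 1) ^ (1 - σ) / (1 - σ) + (1 / 2) * ((n : ℝ) + 1) ^ (-σ)| ≤
        C * ((n : ℝ) + 1) ^ (-σ - 1) := by
  set a : ℕ → ℝ := fun n => ∑ k ∈ Finset.range n, (cpowTrapezoid k σ).re
  have hre : -1 < ((σ : ℝ) : ℂ).re := by simpa using h1
  have hsum := summable_cpowTrapezoid hre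
  have ha : Tendsto a atTop (𝓝 (riemannZeta₁ σ - 1 + (1 - σ) / 2).re) := by
    rw [← tsum_cpowTrapezoid hre]
    have := (Complex.continuous_re.tendsto _).comp hsum.hasSum.tendsto_sum_nat
    refine this.congr fun n => ?_
    simp [a]
  have hinc : ∀ n, |a (n + 1) - a n| ≤ ‖((1 : ℂ) - σ) * σ * (σ + 1)‖ *
      ((n : ℝ) + 1) ^ (-(σ + 1) - 1) := by
    intro n
    have e : a (n + 1) - a n = (cpowTrapezoid n σ).re := by
      simp only [a, Finset.sum_range_succ]; ring
    rw [e]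
    refine (Complex.abs_re_le_norm _).trans ((norm_cpowTrapezoid_le n h1 (by simp)).trans ?_)
    rw [show -(σ + 1) - 1 = -σ - 2 by ring]
  have hb := abs_sub_le_of_increment_le (by linarith) ha hinc
  refine ⟨(‖((1 : ℂ) - σ) * σ * (σ + 1)‖ * 2 ^ (σ + 1 + 1) / (σ + 1)) / (1 - σ), fun n => ?_⟩
  have hval : a n = ((n : ℝ) + 1) ^ (1 - σ) - 1 - (1 - σ) *
      (∑ k ∈ Finset.range n, ((k : ℝ) + 1) ^ (-σ) + (1 / 2) * ((n : ℝ) + 1) ^ (-σ) - 1 / 2) := by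
    have hc : ∀ (k : ℕ) (r : ℝ), ((k : ℂ) + 1) ^ (r : ℂ) = ((((k : ℝ) + 1) ^ r : ℝ) : ℂ) := by
      intro k r
      rw [Complex.ofReal_cpow (by positivity)]
      push_cast
      rfl
    have e := sum_cpowTrapezoid σ n
    have e1 := hc n (1 - σ)
    have e2 := hc n (-σ)
    have e3 : ∑ k ∈ Finset.range n, ((k : ℂ) + 1) ^ (-σ : ℂ) =
        ((∑ k ∈ Finset.range n, ((k : ℝ) + 1) ^ (-σ) : ℝ) : ℂ) := by
      rw [Complex.ofReal_sum]
      refine Finset.sum_congr rfl fun k _ => ?_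
      rw [← hc k (-σ)]
      push_cast
      rfl
    push_cast at e1 e2
    rw [e1, e2, e3] at e
    have e4 := congrArg Complex.re e
    simp only [a]
    rw [← Complex.re_sum, e4, ← Complex.ofReal_re (((n : ℝ) + 1) ^ (1 - σ) - 1 - (1 - σ) *
      (∑ k ∈ Finset.range n, ((k : ℝ) + 1) ^ (-σ) + (1 / 2) * ((n : ℝ) + 1) ^ (-σ) - 1 / 2))]
    congr 1
    push_cast
    ring
  have hs1 : (σ : ℂ) ≠ 1 := by exact_mod_cast h2.ne
  have hL : (riemannZeta₁ σ - 1 + (1 - σ) / 2).re = (σ - 1) * zr σ - 1 + (1 - σ) / 2 := by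
    have e : riemannZeta₁ σ = ((σ - 1 : ℝ) : ℂ) * riemannZeta σ := by
      rw [riemannZeta_eq_inv_sub_mul hs1]
      have : (σ : ℂ) - 1 ≠ 0 := sub_ne_zero.2 hs1
      push_cast
      field_simp
    have e2 : ((1 - (σ : ℂ)) / 2) = (((1 - σ) / 2 : ℝ) : ℂ) := by push_cast; rfl
    rw [e, e2, Complex.add_re, Complex.sub_re, Complex.re_ofReal_mul, Complex.ofReal_re, zr]
    simp
  have hn := hb n
  rw [hval, hL] at hn
  have hσ : 0 < 1 - σ := by linarith
  set X := ∑ k ∈ Finset.range n, ((k : ℝ) + 1) ^ (-σ)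
  set K := ‖((1 : ℂ) - σ) * σ * (σ + 1)‖ * 2 ^ (σ + 1 + 1) / (σ + 1)
  have e : X - zr σ - ((n : ℝ) + 1) ^ (1 - σ) / (1 - σ) + (1 / 2) * ((n : ℝ) + 1) ^ (-σ) =
      -(((n : ℝ) + 1) ^ (1 - σ) - 1 - (1 - σ) * (X + (1 / 2) * ((n : ℝ) + 1) ^ (-σ) - 1 / 2)
        - ((σ - 1) * zr σ - 1 + (1 - σ) / 2)) / (1 - σ) := by
    field_simp
    ring
  rw [e, abs_div, abs_neg, abs_of_pos hσ, div_mul_eq_mul_div (K), show -σ - 1 = -(σ + 1) by ring]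
  exact div_le_div_of_nonneg_right hn hσ.le

lemma exists_sum_rpow_le {σ : ℝ} (h1 : -1 < σ) (h2 : σ < 1) :
    ∃ C, 0 ≤ C ∧ ∀ n : ℕ, ∑ k ∈ Finset.range n, ((k : ℝ) + 1) ^ (-σ) ≤
      C * ((n : ℝ) + 1) ^ (1 - σ) := by
  obtain ⟨C, hC⟩ := exists_abs_sum_rpow_sub_le h1 h2
  refine ⟨|zr σ| + 1 / (1 - σ) + |C|, ?_, fun n => ?_⟩
  · have : 0 < 1 - σ := by linarith
    positivity
  have hn : (1 : ℝ) ≤ (n : ℝ) + 1 := by linarith [n.cast_nonneg (α := ℝ)]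
  have i1 := (abs_le.1 (hC n)).2
  have i2 : ((n : ℝ) + 1) ^ (-σ - 1) ≤ ((n : ℝ) + 1) ^ (1 - σ) :=
    Real.rpow_le_rpow_of_exponent_le hn (by linarith)
  have i3 : 1 ≤ ((n : ℝ) + 1) ^ (1 - σ) := Real.one_le_rpow hn (by linarith)
  have i4 : 0 ≤ ((n : ℝ) + 1) ^ (-σ) := by positivity
  have i5 : 0 ≤ ((n : ℝ) + 1) ^ (-σ - 1) := by positivity
  have i6 : C * ((n : ℝ) + 1) ^ (-σ - 1) ≤ |C| * ((n : ℝ) + 1) ^ (1 - σ) :=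
    mul_le_mul (le_abs_self _) i2 i5 (abs_nonneg _)
  have i7 : zr σ ≤ |zr σ| * ((n : ℝ) + 1) ^ (1 - σ) :=
    (le_abs_self _).trans (le_mul_of_one_le_right (abs_nonneg _) i3)
  rw [add_mul, add_mul, one_div_mul_eq_div]
  linarith

/-- The expansion of the partial sums of `k ^ (-σ)`, rescaled to a mesh of `[0, x]`. -/
lemma exists_abs_mesh_sum_rpow_sub_le {σ x : ℝ} (h1 : -1 < σ) (h2 : σ < 1) (hx : 0 < x) :
    ∃ C, ∀ m : ℕ, ∀ h : ℝ, h = x / (m + 1) →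
      |h ^ (1 - σ) * ∑ k ∈ Finset.range m, ((k : ℝ) + 1) ^ (-σ) - zr σ * h ^ (1 - σ)
        - x ^ (1 - σ) / (1 - σ) + h / 2 * x ^ (-σ)| ≤ C * h ^ 2 := by
  obtain ⟨C, hC⟩ := exists_abs_sum_rpow_sub_le h1 h2
  refine ⟨C * x ^ (-σ - 1), fun m h hh => ?_⟩
  have hm : (0 : ℝ) < (m : ℝ) + 1 := by positivity
  have hpos : 0 < h := by rw [hh]; positivity
  have hxe : x = h * (m + 1) := by rw [hh]; field_simp
  have e1 : x ^ (1 - σ) = h ^ (1 - σ) * ((m : ℝ) + 1) ^ (1 - σ) := by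
    rw [hxe, Real.mul_rpow hpos.le hm.le]
  have e2 : h * x ^ (-σ) = h ^ (1 - σ) * ((m : ℝ) + 1) ^ (-σ) := by
    rw [hxe, Real.mul_rpow hpos.le hm.le, ← mul_assoc, sub_eq_add_neg, Real.rpow_one_add' hpos.le]
    linarith
  have e3 : h ^ 2 * x ^ (-σ - 1) = h ^ (1 - σ) * ((m : ℝ) + 1) ^ (-σ - 1) := by
    rw [hxe, Real.mul_rpow hpos.le hm.le, ← mul_assoc, ← Real.rpow_natCast h 2,
      ← Real.rpow_add hpos]
    congr 2
    push_cast
    ring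
  have key := mul_le_mul_of_nonneg_left (hC m) (Real.rpow_nonneg hpos.le (1 - σ))
  rw [← abs_of_nonneg (Real.rpow_nonneg hpos.le (1 - σ)), ← abs_mul,
    abs_of_nonneg (Real.rpow_nonneg hpos.le (1 - σ))] at key
  refine (le_of_eq ?_).trans (key.trans (le_of_eq ?_))
  · congr 1
    rw [e1]
    linear_combination (1 / 2) * e2
  · linear_combination (-C) * e3

/-- Error of the central difference quotient. -/
lemma abs_central_difference_sub_le_s1 {u u' u'' u''' : ℝ → ℝ} {c h M : ℝ} (hh : 0 ≤ h)
    (h1 : ∀ t, HasDerivAt u (u' t) t) (h2 : ∀ t, HasDerivAt u' (u'' t) t)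
    (h3 : ∀ t, HasDerivAt u'' (u''' t) t)
    (hM : ∀ t ∈ Set.Icc (c - h) (c + h), |u''' t| ≤ M) :
    |u (c + h) - u (c - h) - 2 * h * u' c| ≤ 2 * M * h ^ 3 := by
  have hM0 : 0 ≤ M := (abs_nonneg _).trans (hM c ⟨by linarith, by linarith⟩)
  have hadd : ∀ s, HasDerivAt (fun s : ℝ => c + s) 1 s := fun s => (hasDerivAt_id s).const_add c
  have hsub : ∀ s, HasDerivAt (fun s : ℝ => c - s) (-1) s := fun s => (hasDerivAt_id s).const_sub c
  have hs0 : (0 : ℝ) ∈ Set.Icc 0 h := ⟨le_rfl, hh⟩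
  have b1 : ∀ s ∈ Set.Icc 0 h, |u'' (c + s) - u'' (c - s)| ≤ M * (2 * h) := by
    intro s hs
    refine (Convex.norm_image_sub_le_of_norm_hasDerivWithin_le
      (fun t _ => (h3 t).hasDerivWithinAt) hM (convex_Icc _ _)
      (x := c - s) (y := c + s) ⟨by linarith [hs.2], by linarith [hs.1]⟩
      ⟨by linarith [hs.1], by linarith [hs.2]⟩).trans ?_
    gcongr
    rw [Real.norm_eq_abs, abs_le]
    constructor <;> linarith [hs.1, hs.2]
  have b2 : ∀ s ∈ Set.Icc 0 h, |u' (c + s) + u' (c - s) - 2 * u' c| ≤ M * (2 * h) * h := by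
    intro s hs
    have hd : ∀ t ∈ Set.Icc 0 h, HasDerivWithinAt (fun t => u' (c + t) + u' (c - t))
        (u'' (c + t) * 1 + u'' (c - t) * (-1)) (Set.Icc 0 h) t := fun t _ =>
      (((h2 _).comp t (hadd t)).add ((h2 _).comp t (hsub t))).hasDerivWithinAt
    have := Convex.norm_image_sub_le_of_norm_hasDerivWithin_le hd
      (fun t ht => by simpa [← sub_eq_add_neg] using b1 t ht) (convex_Icc _ _) hs0 hs
    rw [Real.norm_eq_abs, Real.norm_eq_abs, sub_zero s, abs_of_nonneg hs.1] at this
    calc _ = |u' (c + s) + u' (c - s) - (u' (c + 0) + u' (c - 0))| := by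
          rw [add_zero, sub_zero]; ring_nf
      _ ≤ M * (2 * h) * s := this
      _ ≤ _ := by gcongr; exact hs.2
  have hd : ∀ t ∈ Set.Icc 0 h, HasDerivWithinAt (fun t => u (c + t) - u (c - t) - t * (2 * u' c))
      (u' (c + t) * 1 - u' (c - t) * (-1) - 1 * (2 * u' c)) (Set.Icc 0 h) t := fun t _ =>
    ((((h1 _).comp t (hadd t)).sub ((h1 _).comp t (hsub t))).sub
      ((hasDerivAt_id t).mul_const _)).hasDerivWithinAt
  have := Convex.norm_image_sub_le_of_norm_hasDerivWithin_le hd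
    (fun t ht => by
      have := b2 t ht
      rw [Real.norm_eq_abs]
      convert this using 2
      ring) (convex_Icc _ _) hs0 ⟨hh, le_rfl⟩
  rw [Real.norm_eq_abs, Real.norm_eq_abs, sub_zero h, abs_of_nonneg hh] at this
  calc _ = |u (c + h) - u (c - h) - h * (2 * u' c) -
        (u (c + 0) - u (c - 0) - 0 * (2 * u' c))| := by rw [add_zero, sub_zero]; ring_nf
    _ ≤ M * (2 * h) * h * h := this
    _ = _ := by ring

/-- Trapezoidal rule for `t ^ (-α) * r t` on `[0, x]`, where `r` vanishes to second order at `0`. -/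
lemma exists_abs_weighted_trapezoid_sub_le {α x M : ℝ} (hα0 : 0 < α) (hα1 : α < 1) (hx : 0 < x)
    {r r' r'' : ℝ → ℝ} (hr : ∀ t, HasDerivAt r (r' t) t) (hr' : ∀ t, HasDerivAt r' (r'' t) t)
    (hr0 : r 0 = 0) (hr'0 : r' 0 = 0) (hM : ∀ t ∈ Set.Icc 0 x, |r'' t| ≤ M) :
    ∃ C, ∀ m : ℕ, ∀ h : ℝ, h = x / (m + 1) →
      |h * ∑ k ∈ Finset.range m, (((k : ℝ) + 1) * h) ^ (-α) * r ((k + 1) * h)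
        + h / 2 * (x ^ (-α) * r x) - ∫ t in (0 : ℝ)..x, t ^ (-α) * r t| ≤ C * h ^ 2 := by
  have h0I : (0 : ℝ) ∈ Set.Icc 0 x := ⟨le_rfl, hx.le⟩
  have hM0 : 0 ≤ M := (abs_nonneg _).trans (hM 0 h0I)
  have b1 : ∀ t ∈ Set.Icc 0 x, |r' t| ≤ M * t := by
    intro t ht
    have := Convex.norm_image_sub_le_of_norm_hasDerivWithin_le
      (fun s _ => (hr' s).hasDerivWithinAt) hM (convex_Icc 0 x) h0I ht
    simpa [hr'0, abs_of_nonneg ht.1] using this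
  have b0 : ∀ t ∈ Set.Icc 0 x, |r t| ≤ M * t ^ 2 := by
    intro t ht
    have := Convex.norm_image_sub_le_of_norm_hasDerivWithin_le (C := M * t)
      (fun s _ => (hr s).hasDerivWithinAt)
      (fun s hs => (b1 s ⟨hs.1, hs.2.trans ht.2⟩).trans (mul_le_mul_of_nonneg_left hs.2 hM0))
      (convex_Icc 0 t) ⟨le_rfl, ht.1⟩ ⟨ht.1, le_rfl⟩
    rw [hr0, sub_zero, sub_zero, Real.norm_eq_abs, Real.norm_eq_abs, abs_of_nonneg ht.1] at this
    linarith
  set f : ℝ → ℝ := fun t => t ^ (-α) * r t with hf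
  set F : ℝ → ℝ := fun u => ∫ t in (0 : ℝ)..u, f t with hF
  have hrc : Continuous r := continuous_iff_continuousAt.2 fun t => (hr t).continuousAt
  have hint : ∀ a b : ℝ, IntervalIntegrable f MeasureTheory.volume a b := fun a b =>
    (intervalIntegral.intervalIntegrable_rpow' (by linarith)).mul_continuousOn hrc.continuousOn
  have hmeas : Measurable f := (measurable_id.pow_const _).mul hrc.measurable
  have hFd : ∀ t, 0 < t → HasDerivAt F (f t) t := fun t ht =>
    intervalIntegral.integral_hasDerivAt_right (hint 0 t)
      hmeas.stronglyMeasurable.stronglyMeasurableAtFilter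
      ((Real.continuousAt_rpow_const _ _ (Or.inl ht.ne')).mul hrc.continuousAt)
  have hpow : ∀ p t : ℝ, 0 < t → HasDerivAt (fun t : ℝ => t ^ p) (p * t ^ (p - 1)) t :=
    fun p t ht => Real.hasDerivAt_rpow_const (Or.inl ht.ne')
  have hfd : ∀ t, 0 < t → HasDerivAt f (-α * t ^ (-α - 1) * r t + t ^ (-α) * r' t) t :=
    fun t ht => (hpow _ t ht).mul (hr t)
  have hfd' : ∀ t, 0 < t → HasDerivAt (fun t => -α * t ^ (-α - 1) * r t + t ^ (-α) * r' t)
      (-α * ((-α - 1) * t ^ (-α - 1 - 1)) * r t + -α * t ^ (-α - 1) * r' t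
        + (-α * t ^ (-α - 1) * r' t + t ^ (-α) * r'' t)) t :=
    fun t ht => (((hpow _ t ht).const_mul (-α)).mul (hr t)).add ((hpow _ t ht).mul (hr' t))
  have hfb : ∀ t, 0 < t → t ≤ x →
      |-α * ((-α - 1) * t ^ (-α - 1 - 1)) * r t + -α * t ^ (-α - 1) * r' t
        + (-α * t ^ (-α - 1) * r' t + t ^ (-α) * r'' t)| ≤ 5 * M * t ^ (-α) := by
    intro t ht htx
    have hI : t ∈ Set.Icc 0 x := ⟨ht.le, htx⟩
    have e1 : t ^ (-α - 1) = t ^ (-α) / t := Real.rpow_sub_one ht.ne' _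
    have e2 : t ^ (-α - 1 - 1) = t ^ (-α) / t ^ 2 := by
      rw [Real.rpow_sub_one ht.ne', e1]
      field_simp
    set P := t ^ (-α)
    have hP : 0 ≤ P := Real.rpow_nonneg ht.le _
    have e : -α * ((-α - 1) * t ^ (-α - 1 - 1)) * r t + -α * t ^ (-α - 1) * r' t
        + (-α * t ^ (-α - 1) * r' t + P * r'' t) =
        P * (α * (α + 1) * (r t / t ^ 2) - 2 * α * (r' t / t) + r'' t) := by
      rw [e1, e2]
      field_simp
      ring
    have c0 : |r t / t ^ 2| ≤ M := by
      rw [abs_div, abs_of_pos (by positivity : 0 < t ^ 2), div_le_iff₀ (by positivity)]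
      exact b0 t hI
    have c1 : |r' t / t| ≤ M := by
      rw [abs_div, abs_of_pos ht, div_le_iff₀ ht]
      exact b1 t hI
    have c2 := hM t hI
    rw [e, abs_mul, abs_of_nonneg hP, mul_comm]
    gcongr
    rw [abs_le] at c0 c1 c2 ⊢
    have hα2 : α * (α + 1) ≤ 2 := by nlinarith
    have hα3 : 0 ≤ α * (α + 1) := by positivity
    constructor <;> nlinarith
  obtain ⟨C, hC0, hC⟩ := exists_sum_rpow_le (σ := α) (by linarith) hα1
  refine ⟨2 * M * x ^ (1 - α) + 5 * M * C * x ^ (1 - α), fun m h hh => ?_⟩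
  have hm : (0 : ℝ) < (m : ℝ) + 1 := by positivity
  have hpos : 0 < h := by rw [hh]; positivity
  have hxe : ((m : ℝ) + 1) * h = x := by rw [hh]; field_simp
  have hstart : |h / 2 * f h - F h| ≤ 2 * M * x ^ (1 - α) * h ^ 2 := by
    have hhx : h ≤ x := by
      rw [← hxe]
      exact le_mul_of_one_le_left hpos.le (by linarith [m.cast_nonneg (α := ℝ)])
    have hfle : ∀ t, 0 < t → t ≤ h → |f t| ≤ M * (x ^ (1 - α) * h) := by
      intro t ht hth
      have e : t ^ (-α) * t ^ 2 = t ^ (1 - α) * t := by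
        rw [sub_eq_add_neg, Real.rpow_add ht, Real.rpow_one]; ring
      rw [hf]
      simp only
      rw [abs_mul, abs_of_nonneg (Real.rpow_nonneg ht.le _)]
      calc t ^ (-α) * |r t| ≤ t ^ (-α) * (M * t ^ 2) := by
            gcongr
            exact b0 t ⟨ht.le, hth.trans hhx⟩
        _ = M * (t ^ (1 - α) * t) := by rw [← e]; ring
        _ ≤ _ := by
            have : t ^ (1 - α) ≤ x ^ (1 - α) :=
              Real.rpow_le_rpow ht.le (hth.trans hhx) (by linarith)
            gcongr
    have i1 : |F h| ≤ M * (x ^ (1 - α) * h) * |h - 0| := by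
      refine intervalIntegral.norm_integral_le_of_norm_le_const (f := f) fun t ht => ?_
      rw [Set.uIoc_of_le hpos.le] at ht
      exact hfle t ht.1 ht.2
    rw [sub_zero, abs_of_pos hpos] at i1
    have i2 := hfle h hpos le_rfl
    have i3 : |h / 2 * f h| ≤ h / 2 * (M * (x ^ (1 - α) * h)) := by
      rw [abs_mul, abs_of_pos (by positivity : 0 < h / 2)]
      gcongr
    have i4 : 0 ≤ M * (x ^ (1 - α) * h) * h := by positivity
    refine (abs_sub _ _).trans ?_
    nlinarith
  have hind : ∀ j : ℕ, j ≤ m →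
      |h * ∑ k ∈ Finset.range j, f ((k + 1) * h) + h / 2 * f ((j + 1) * h) - F ((j + 1) * h)| ≤
        2 * M * x ^ (1 - α) * h ^ 2 +
          ∑ k ∈ Finset.range j, 5 * M * (((k : ℝ) + 1) * h) ^ (-α) * h ^ 3 := by
    intro j
    induction j with
    | zero => intro _; simpa using hstart
    | succ j ih =>
      intro hj
      have hjm : (j : ℝ) + 1 ≤ m := by exact_mod_cast hj
      have hj0 : (0 : ℝ) < ((j : ℝ) + 1) * h := by positivity
      have hI : ∀ t ∈ Set.Icc (((j : ℝ) + 1) * h) ((j + 1 + 1) * h), 0 < t ∧ t ≤ x := by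
        refine fun t ht => ⟨hj0.trans_le ht.1, ht.2.trans ?_⟩
        rw [← hxe]
        gcongr
      have := norm_trapezoid_error_le (a := ((j : ℝ) + 1) * h) (b := (j + 1 + 1) * h)
        (M := 5 * M * (((j : ℝ) + 1) * h) ^ (-α)) (by nlinarith)
        (fun t ht => hFd t (hI t ht).1) (fun t ht => hfd t (hI t ht).1)
        (fun t ht => hfd' t (hI t ht).1) (fun t ht => by
          refine (hfb t (hI t ht).1 (hI t ht).2).trans ?_
          have := Real.rpow_le_rpow_of_nonpos hj0 ht.1 (show -α ≤ 0 by linarith)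
          gcongr)
      have e : ((j : ℝ) + 1 + 1) * h - (j + 1) * h = h := by ring
      rw [e, Real.norm_eq_abs, smul_eq_mul] at this
      rw [Finset.sum_range_succ, Finset.sum_range_succ]
      have ihj := ih (by omega)
      push_cast
      rw [abs_le] at this ihj ⊢
      constructor <;> linarith
  have hfin := hind m le_rfl
  rw [hxe] at hfin
  refine hfin.trans ?_
  have hsum : ∑ k ∈ Finset.range m, 5 * M * (((k : ℝ) + 1) * h) ^ (-α) * h ^ 3 =
      5 * M * h ^ 2 * (h ^ (1 - α) * ∑ k ∈ Finset.range m, ((k : ℝ) + 1) ^ (-α)) := by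
    rw [Finset.mul_sum, Finset.mul_sum]
    refine Finset.sum_congr rfl fun k _ => ?_
    rw [Real.mul_rpow (by positivity) hpos.le, sub_eq_add_neg, Real.rpow_add hpos, Real.rpow_one]
    ring
  have hx' : x ^ (1 - α) = h ^ (1 - α) * ((m : ℝ) + 1) ^ (1 - α) := by
    rw [← hxe, Real.mul_rpow hm.le hpos.le, mul_comm]
  have : h ^ (1 - α) * ∑ k ∈ Finset.range m, ((k : ℝ) + 1) ^ (-α) ≤ C * x ^ (1 - α) := by
    rw [hx', mul_left_comm]
    gcongr
    exact hC m
  rw [hsum]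
  calc _ ≤ 2 * M * x ^ (1 - α) * h ^ 2 + 5 * M * h ^ 2 * (C * x ^ (1 - α)) := by gcongr
    _ = _ := by ring

lemma sum_mul_central_difference (w Y : ℕ → ℝ) (p : ℕ) :
    ∑ k ∈ Finset.range (p + 3), w (k + 1) * (Y k - Y (k + 2)) =
      w 1 * Y 0 + w 2 * Y 1 + ∑ k ∈ Finset.Icc 2 (p + 2), (w (k + 1) - w (k - 1)) * Y k
        - w (p + 2) * Y (p + 3) - w (p + 3) * Y (p + 4) := by
  induction p with
  | zero => simp [Finset.sum_range_succ]; ring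
  | succ p ih =>
    rw [Finset.sum_range_succ, show p + 1 + 2 = (p + 2) + 1 by ring,
      Finset.sum_Icc_succ_top (by omega), show p + 1 + 2 = p + 3 by ring, ih]
    simp only [show p + 1 + 3 = p + 4 by ring, show p + 1 + 4 = p + 5 by ring,
      show p + 3 - 1 = p + 2 by omega]
    ring

lemma hasDerivAt_deriv_of_contDiff {u : ℝ → ℝ} (hu : ContDiff ℝ (⊤ : ℕ∞) u) :
    (∀ t, HasDerivAt u (deriv u t) t) ∧ ContDiff ℝ (⊤ : ℕ∞) (deriv u) :=
  ⟨fun t => ((contDiff_infty_iff_deriv.1 hu).1 t).hasDerivAt, (contDiff_infty_iff_deriv.1 hu).2⟩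

lemma exists_abs_difference_sum_sub_le {α x : ℝ} (hα0 : 0 < α) (hα1 : α < 1) (hx : 0 < x)
    {y : ℝ → ℝ} (hy : ContDiff ℝ (⊤ : ℕ∞) y) (hy'0 : deriv y 0 = 0) :
    ∃ C, ∀ m : ℕ, ∀ h : ℝ, h = x / (m + 1) →
      |(∑ k ∈ Finset.range m, ((k : ℝ) + 1) ^ (-α) * (y (x - k * h) - y (x - (k + 2) * h))) /
          (2 * h ^ α) - (∫ t in (0 : ℝ)..x, deriv y t / (x - t) ^ α)
        - zr α * deriv y x * h ^ (1 - α)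
        + zr (α - 1) * iteratedDeriv 2 y x * h ^ (2 - α)| ≤ C * h ^ 2 := by
  obtain ⟨d0, hy1⟩ := hasDerivAt_deriv_of_contDiff hy
  obtain ⟨d1, hy2⟩ := hasDerivAt_deriv_of_contDiff hy1
  obtain ⟨d2, hy3⟩ := hasDerivAt_deriv_of_contDiff hy2
  have hit : iteratedDeriv 2 y = deriv (deriv y) := by
    rw [iteratedDeriv_succ, iteratedDeriv_one]
  rw [hit]
  set y1 := deriv y
  set y2 := deriv y1
  set y3 := deriv y2
  obtain ⟨M, hM⟩ := (isCompact_Icc (a := (0 : ℝ)) (b := x)).exists_bound_of_continuousOn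
    hy3.continuous.continuousOn
  have hM0 : 0 ≤ M := (norm_nonneg _).trans (hM 0 ⟨le_rfl, hx.le⟩)
  set A := y1 x
  set B := -y2 x
  set r : ℝ → ℝ := fun t => y1 (x - t) - A - t * B with hr
  have hsub : ∀ s, HasDerivAt (fun s : ℝ => x - s) (-1) s := fun s => (hasDerivAt_id s).const_sub x
  have hrd : ∀ t, HasDerivAt r (y2 (x - t) * (-1) - 1 * B) t := fun t =>
    (((d1 _).comp t (hsub t)).sub_const A).sub ((hasDerivAt_id t).mul_const B)
  have hrd' : ∀ t, HasDerivAt (fun t => y2 (x - t) * (-1) - 1 * B) (y3 (x - t) * (-1) * (-1)) t :=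
    fun t => (((d2 _).comp t (hsub t)).mul_const (-1)).sub_const _
  obtain ⟨C1, hC1⟩ := exists_abs_weighted_trapezoid_sub_le hα0 hα1 hx hrd hrd' (by simp [hr, A])
    (by simp [B]) (M := M) (fun t ht => by
      have := hM (x - t) ⟨by linarith [ht.2], by linarith [ht.1]⟩
      simpa using this)
  obtain ⟨C2, hC2⟩ := exists_abs_mesh_sum_rpow_sub_le (σ := α) (by linarith) hα1 hx
  obtain ⟨C3, hC3⟩ := exists_abs_mesh_sum_rpow_sub_le (σ := α - 1) (by linarith) (by linarith) hx
  obtain ⟨C4, hC40, hC4⟩ := exists_sum_rpow_le (σ := α) (by linarith) hα1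
  have hint : ∀ p : ℝ, -1 < p → IntervalIntegrable (fun t : ℝ => t ^ p) MeasureTheory.volume 0 x :=
    fun p hp => intervalIntegral.intervalIntegrable_rpow' hp
  have hrc : Continuous r := continuous_iff_continuousAt.2 fun t => (hrd t).continuousAt
  have hI : ∫ t in (0 : ℝ)..x, y1 t / (x - t) ^ α =
      A * (x ^ (1 - α) / (1 - α)) + B * (x ^ (2 - α) / (2 - α)) +
        ∫ t in (0 : ℝ)..x, t ^ (-α) * r t := by
    have e1 := intervalIntegral.integral_comp_sub_left (a := 0) (b := x)
      (fun t => y1 t / (x - t) ^ α) x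
    rw [sub_zero, sub_self] at e1
    rw [← e1]
    have e2 : ∫ t in (0 : ℝ)..x, y1 (x - t) / (x - (x - t)) ^ α =
        ∫ t in (0 : ℝ)..x, (A * t ^ (-α) + B * t ^ (1 - α) + t ^ (-α) * r t) := by
      refine intervalIntegral.integral_congr_ae (Filter.Eventually.of_forall fun t ht => ?_)
      rw [Set.uIoc_of_le hx.le] at ht
      have e3 : t ^ (1 - α) = t * t ^ (-α) := by
        rw [sub_eq_add_neg, Real.rpow_add ht.1, Real.rpow_one]
      rw [sub_sub_cancel, e3, div_eq_mul_inv, ← Real.rpow_neg ht.1.le]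
      simp only [hr]
      ring
    rw [e2, intervalIntegral.integral_add, intervalIntegral.integral_add,
      intervalIntegral.integral_const_mul, intervalIntegral.integral_const_mul,
      integral_rpow (Or.inl (by linarith)), integral_rpow (Or.inl (by linarith)),
      Real.zero_rpow (by linarith), Real.zero_rpow (by linarith)]
    · rw [show -α + 1 = 1 - α by ring, show 1 - α + 1 = 2 - α by ring, sub_zero, sub_zero]
    · exact (hint _ (by linarith)).const_mul A
    · exact (hint _ (by linarith)).const_mul B
    · exact ((hint _ (by linarith)).const_mul A).add ((hint _ (by linarith)).const_mul B)
    · exact (hint _ (by linarith)).mul_continuousOn hrc.continuousOn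
  refine ⟨M * C4 * x ^ (1 - α) + |A| * C2 + |B| * C3 + C1, fun m h hh => ?_⟩
  have hm : (0 : ℝ) < (m : ℝ) + 1 := by positivity
  have hpos : 0 < h := by rw [hh]; positivity
  have hxe : ((m : ℝ) + 1) * h = x := by rw [hh]; field_simp
  have hhα : 0 < h ^ α := Real.rpow_pos_of_pos hpos α
  have hh1 : h ^ (1 - α) = h / h ^ α := by rw [Real.rpow_sub hpos, Real.rpow_one]
  have hh2 : h ^ (2 - α) = h * h ^ (1 - α) := by
    rw [show 2 - α = 1 + (1 - α) by ring, Real.rpow_add hpos, Real.rpow_one]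
  have hdiff : |(∑ k ∈ Finset.range m, ((k : ℝ) + 1) ^ (-α) *
      (y (x - k * h) - y (x - (k + 2) * h))) / (2 * h ^ α) -
        h ^ (1 - α) * ∑ k ∈ Finset.range m, ((k : ℝ) + 1) ^ (-α) * y1 (x - (k + 1) * h)| ≤
      M * C4 * x ^ (1 - α) * h ^ 2 := by
    have e : (∑ k ∈ Finset.range m, ((k : ℝ) + 1) ^ (-α) *
        (y (x - k * h) - y (x - (k + 2) * h))) / (2 * h ^ α) -
        h ^ (1 - α) * ∑ k ∈ Finset.range m, ((k : ℝ) + 1) ^ (-α) * y1 (x - (k + 1) * h) =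
        (∑ k ∈ Finset.range m, ((k : ℝ) + 1) ^ (-α) * (y (x - k * h) - y (x - (k + 2) * h)
          - 2 * h * y1 (x - (k + 1) * h))) / (2 * h ^ α) := by
      simp only [mul_sub _ (_ - _) (_ : ℝ), Finset.sum_sub_distrib, sub_div]
      congr 1
      rw [hh1, Finset.mul_sum, Finset.sum_div]
      refine Finset.sum_congr rfl fun k _ => ?_
      field_simp
    have b : |∑ k ∈ Finset.range m, ((k : ℝ) + 1) ^ (-α) * (y (x - k * h) - y (x - (k + 2) * h)
          - 2 * h * y1 (x - (k + 1) * h))| ≤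
        ∑ k ∈ Finset.range m, ((k : ℝ) + 1) ^ (-α) * (2 * M * h ^ 3) := by
      refine (Finset.abs_sum_le_sum_abs _ _).trans (Finset.sum_le_sum fun k hk => ?_)
      have hkm : (k : ℝ) + 1 ≤ m := by exact_mod_cast Finset.mem_range.1 hk
      rw [abs_mul, abs_of_nonneg (by positivity : 0 ≤ ((k : ℝ) + 1) ^ (-α))]
      have := abs_central_difference_sub_le_s1 (c := x - (k + 1) * h) (M := M) hpos.le d0 d1 d2
        (fun t ht => hM t ⟨by
          refine le_trans ?_ ht.1
          rw [← hxe]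
          nlinarith, ht.2.trans (by nlinarith [mul_nonneg (k.cast_nonneg (α := ℝ)) hpos.le])⟩)
      rw [show x - (k + 1) * h + h = x - k * h by ring,
        show x - (k + 1) * h - h = x - (k + 2) * h by ring] at this
      gcongr
    rw [e, abs_div, abs_of_pos (by positivity : 0 < 2 * h ^ α), div_le_iff₀ (by positivity)]
    refine b.trans ?_
    rw [← Finset.sum_mul]
    have hx' : h ^ α * x ^ (1 - α) = h * ((m : ℝ) + 1) ^ (1 - α) := by
      rw [← hxe, Real.mul_rpow hm.le hpos.le, hh1]
      field_simp
    calc _ ≤ C4 * ((m : ℝ) + 1) ^ (1 - α) * (2 * M * h ^ 3) := by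
          gcongr
          exact hC4 m
      _ = 2 * M * C4 * h ^ 2 * (h * ((m : ℝ) + 1) ^ (1 - α)) := by ring
      _ = _ := by rw [← hx']; ring
  have hsplit : h ^ (1 - α) * ∑ k ∈ Finset.range m, ((k : ℝ) + 1) ^ (-α) * y1 (x - (k + 1) * h) =
      A * (h ^ (1 - α) * ∑ k ∈ Finset.range m, ((k : ℝ) + 1) ^ (-α)) +
      B * (h ^ (2 - α) * ∑ k ∈ Finset.range m, ((k : ℝ) + 1) ^ (1 - α)) +
      h * ∑ k ∈ Finset.range m, (((k : ℝ) + 1) * h) ^ (-α) * r ((k + 1) * h) := by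
    simp only [Finset.mul_sum]
    rw [← Finset.sum_add_distrib, ← Finset.sum_add_distrib]
    refine Finset.sum_congr rfl fun k _ => ?_
    have hk : (0 : ℝ) < (k : ℝ) + 1 := by positivity
    rw [Real.mul_rpow hk.le hpos.le, hh2, sub_eq_add_neg, Real.rpow_add hpos, Real.rpow_add hk,
      Real.rpow_one, Real.rpow_one]
    simp only [hr]
    ring
  have c1 := hC1 m h hh
  have c2 := mul_le_mul_of_nonneg_left (hC2 m h hh) (abs_nonneg A)
  have c3 := hC3 m h hh
  rw [show -(α - 1) = 1 - α by ring, show 1 - (α - 1) = 2 - α by ring] at c3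
  replace c3 := mul_le_mul_of_nonneg_left c3 (abs_nonneg B)
  rw [← abs_mul] at c2 c3
  have hend : A * x ^ (-α) + B * x ^ (1 - α) + x ^ (-α) * r x = 0 := by
    have : x ^ (1 - α) = x * x ^ (-α) := by
      rw [sub_eq_add_neg, Real.rpow_add hx, Real.rpow_one]
    simp only [hr]
    rw [this, sub_self, hy'0]
    ring
  have hend' : h / 2 * (A * x ^ (-α) + B * x ^ (1 - α) + x ^ (-α) * r x) = 0 := by
    rw [hend, mul_zero]
  rw [hsplit] at hdiff
  rw [hI]
  have hB : B = -y2 x := rfl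
  have e9 : y2 x = -B := by rw [hB, neg_neg]
  rw [e9]
  rw [abs_le] at c1 c2 c3 hdiff ⊢
  constructor <;> linarith

theorem expansion_Aomega
    (α x : ℝ) (hα0 : 0 < α) (hα1 : α < 1) (hx : 0 < x)
    (y : ℝ → ℝ) (hy : ContDiff ℝ (⊤ : ℕ∞) y) (hy0 : y 0 = 0) (hy'0 : deriv y 0 = 0) :
    ∃ C > 0, ∀ n : ℕ, 4 ≤ n →
      |(1 / (2 * Real.Gamma (1 - α) * (x / n) ^ α)) *
          (1 * y x
            + (2:ℝ) ^ (-α) * y (x - x / n)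
            + (∑ k ∈ Finset.Icc 2 (n - 2),
                (((k:ℝ) + 1) ^ (-α) - ((k:ℝ) - 1) ^ (-α)) * y (x - (k:ℝ) * (x / n)))
            + (-(((n:ℝ) - 2) ^ (-α))) * y (x - ((n:ℝ) - 1) * (x / n))
            + (-(((n:ℝ) - 1) ^ (-α))) * y (x - (n:ℝ) * (x / n)))
        - caputo α y x
        - (zr α / Real.Gamma (1 - α)) * deriv y x * (x / n) ^ (1 - α)
        + (zr (α - 1) / Real.Gamma (1 - α)) * iteratedDeriv 2 y x * (x / n) ^ (2 - α)|
      ≤ C * (x / n) ^ 2 := by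
  obtain ⟨C, hC⟩ := exists_abs_difference_sum_sub_le hα0 hα1 hx hy hy'0
  have hG : 0 < Real.Gamma (1 - α) := Real.Gamma_pos_of_pos (by linarith)
  set G := Real.Gamma (1 - α)
  refine ⟨(|C| + 1) / G, by positivity, fun n hn => ?_⟩
  obtain ⟨p, rfl⟩ : ∃ p, n = p + 4 := ⟨n - 4, by omega⟩
  set h := x / ((p + 4 : ℕ) : ℝ) with hh
  have hpos : 0 < h := by positivity
  have hhα : 0 < h ^ α := Real.rpow_pos_of_pos hpos α
  have key := hC (p + 3) h (by rw [hh]; push_cast; ring_nf)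
  have hsum := sum_mul_central_difference (fun k => (k : ℝ) ^ (-α)) (fun k => y (x - k * h)) p
  have e1 : ∑ k ∈ Finset.range (p + 3),
      ((k : ℝ) + 1) ^ (-α) * (y (x - k * h) - y (x - (k + 2) * h)) =
      1 * y x + (2 : ℝ) ^ (-α) * y (x - h)
        + (∑ k ∈ Finset.Icc 2 (p + 4 - 2),
            (((k : ℝ) + 1) ^ (-α) - ((k : ℝ) - 1) ^ (-α)) * y (x - (k : ℝ) * h))
        + (-((((p + 4 : ℕ) : ℝ) - 2) ^ (-α))) * y (x - (((p + 4 : ℕ) : ℝ) - 1) * h)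
        + (-((((p + 4 : ℕ) : ℝ) - 1) ^ (-α))) * y (x - ((p + 4 : ℕ) : ℝ) * h) := by
    have e2 : ∑ k ∈ Finset.Icc 2 (p + 4 - 2),
        (((k : ℝ) + 1) ^ (-α) - ((k : ℝ) - 1) ^ (-α)) * y (x - (k : ℝ) * h) =
        ∑ k ∈ Finset.Icc 2 (p + 2),
          (((k + 1 : ℕ) : ℝ) ^ (-α) - ((k - 1 : ℕ) : ℝ) ^ (-α)) * y (x - (k : ℝ) * h) := by
      refine Finset.sum_congr rfl fun k hk => ?_
      have : 1 ≤ k := by have := (Finset.mem_Icc.1 hk).1; omega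
      push_cast [this]
      rfl
    rw [e2]
    have e3 : ((p + 4 : ℕ) : ℝ) - 2 = ((p + 2 : ℕ) : ℝ) := by push_cast; ring
    have e4 : ((p + 4 : ℕ) : ℝ) - 1 = ((p + 3 : ℕ) : ℝ) := by push_cast; ring
    rw [e3, e4]
    have e5 : ∑ k ∈ Finset.range (p + 3),
        ((k : ℝ) + 1) ^ (-α) * (y (x - k * h) - y (x - (k + 2) * h)) =
        ∑ k ∈ Finset.range (p + 3),
          ((k + 1 : ℕ) : ℝ) ^ (-α) * (y (x - k * h) - y (x - (k + 2 : ℕ) * h)) := by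
      push_cast
      rfl
    rw [e5, hsum]
    simp only [Nat.cast_one, Nat.cast_zero, Nat.cast_ofNat, Real.one_rpow, zero_mul, sub_zero,
      one_mul]
    ring
  rw [← e1]
  set S := ∑ k ∈ Finset.range (p + 3),
    ((k : ℝ) + 1) ^ (-α) * (y (x - k * h) - y (x - (k + 2) * h))
  set I := ∫ t in (0 : ℝ)..x, deriv y t / (x - t) ^ α
  have e6 : 1 / (2 * G * h ^ α) * S - caputo α y x - zr α / G * deriv y x * h ^ (1 - α)
      + zr (α - 1) / G * iteratedDeriv 2 y x * h ^ (2 - α) =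
      (S / (2 * h ^ α) - I - zr α * deriv y x * h ^ (1 - α)
        + zr (α - 1) * iteratedDeriv 2 y x * h ^ (2 - α)) / G := by
    have : caputo α y x = 1 / G * I := rfl
    rw [this]
    field_simp
  rw [e6, abs_div, abs_of_pos hG, div_mul_eq_mul_div]
  refine div_le_div_of_nonneg_right (key.trans ?_) hG.le
  gcongr
  linarith [le_abs_self C]
end

section
/- Let 0 < α < 1, x > 0, n ≥ 4 an integer, h = x/n, and define the weights σ̄₀ = 1 − 2ζ(α), σ̄₁ = 2^{−α} + 2ζ(α), σ̄_k = (k+1)^{−α} − (k−1)^{−α} for 2 ≤ k ≤ n−2, σ̄_{n−1} = −(n−2)^{−α}, σ̄_n = −(n−1)^{−α}. Then for the function y(t) = t one has the exact identity (1/(2Γ(1−α)h^α)) Σ_{k=0}^{n} σ̄_k (x − kh) − x^{1−α}/Γ(2−α) = (h^{1−α}/Γ(1−α)) · W_n[α], where W_n[α] = Σ_{k=1}^{n−1} k^{−α} − n^{1−α}/(1−α) − ζ(α). (Note x^{1−α}/Γ(2−α) is the Caputo derivative of order α of y(t) = t evaluated at x.) -/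
/-- Summation by parts for central differences against a linear weight. -/
theorem sum_central_diff_mul_linear (f : ℝ → ℝ) (c : ℝ) (m : ℕ) :
    ∑ k ∈ Finset.Icc 2 (m + 2), (f ((k : ℝ) + 1) - f ((k : ℝ) - 1)) * (c - k)
      = 2 * (∑ k ∈ Finset.Icc 1 (m + 3), f k) - c * f 1 - (c - 1) * f 2
        + (c - m - 3) * f (m + 2) + (c - m - 4) * f (m + 3) := by
  induction m with
  | zero =>
    simp [Finset.sum_Icc_succ_top]
    norm_num
    ring
  | succ m ih =>
    rw [show m + 1 + 2 = (m + 2) + 1 by ring, show m + 1 + 3 = (m + 3) + 1 by ring,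
      Finset.sum_Icc_succ_top (show 2 ≤ m + 2 + 1 by omega),
      Finset.sum_Icc_succ_top (show 1 ≤ m + 3 + 1 by omega), ih]
    push_cast
    rw [show (m : ℝ) + 2 + 1 + 1 = m + 4 by ring, show (m : ℝ) + 2 + 1 - 1 = m + 2 by ring,
      show (m : ℝ) + 3 + 1 = m + 4 by ring, show (m : ℝ) + 1 + 2 = m + 3 by ring,
      show (m : ℝ) + 1 + 3 = m + 4 by ring]
    ring


/-- `W_n[α] = Σ_{k=1}^{n−1} k^{−α} − n^{1−α}/(1−α) − ζ(α)`. -/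
noncomputable def W (n : ℕ) (α : ℝ) : ℝ :=
  (∑ k ∈ Finset.Icc 1 (n - 1), (k:ℝ) ^ (-α)) - (n:ℝ) ^ (1 - α) / (1 - α) - zr α

theorem Asigmabar_on_linear
    (α x : ℝ) (hα0 : 0 < α) (hα1 : α < 1) (hx : 0 < x)
    (n : ℕ) (hn : 4 ≤ n) :
    (1 / (2 * Real.Gamma (1 - α) * (x / n) ^ α)) *
        ((1 - 2 * zr α) * x
          + ((2:ℝ) ^ (-α) + 2 * zr α) * (x - x / n)
          + (∑ k ∈ Finset.Icc 2 (n - 2),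
              (((k:ℝ) + 1) ^ (-α) - ((k:ℝ) - 1) ^ (-α)) * (x - (k:ℝ) * (x / n)))
          + (-(((n:ℝ) - 2) ^ (-α))) * (x - ((n:ℝ) - 1) * (x / n))
          + (-(((n:ℝ) - 1) ^ (-α))) * (x - (n:ℝ) * (x / n)))
      - x ^ (1 - α) / Real.Gamma (2 - α)
    = ((x / n) ^ (1 - α) / Real.Gamma (1 - α)) * W n α := by
  obtain ⟨m, rfl⟩ : ∃ m, n = m + 4 := ⟨n - 4, by omega⟩
  have hn0 : (0 : ℝ) < ((m + 4 : ℕ) : ℝ) := by positivity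
  obtain ⟨h, hh, hxh⟩ : ∃ h : ℝ, 0 < h ∧ x = ((m + 4 : ℕ) : ℝ) * h :=
    ⟨x / ((m + 4 : ℕ) : ℝ), by positivity, by field_simp⟩
  have hdiv : x / ((m + 4 : ℕ) : ℝ) = h := by rw [hxh]; field_simp
  have hG : Real.Gamma (2 - α) = (1 - α) * Real.Gamma (1 - α) := by
    rw [← Real.Gamma_add_one (by linarith)]
    ring_nf
  have hGpos : 0 < Real.Gamma (1 - α) := Real.Gamma_pos_of_pos (by linarith)
  have hα : 1 - α ≠ 0 := by linarith
  have hpow : h = h ^ (1 - α) * h ^ α := by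
    rw [← Real.rpow_add hh]
    simp
  have hhα : 0 < h ^ α := Real.rpow_pos_of_pos hh α
  have hsum : ∑ k ∈ Finset.Icc 2 (m + 2),
      (((k : ℝ) + 1) ^ (-α) - ((k : ℝ) - 1) ^ (-α)) * (x - (k : ℝ) * h)
      = h * ∑ k ∈ Finset.Icc 2 (m + 2),
        (((k : ℝ) + 1) ^ (-α) - ((k : ℝ) - 1) ^ (-α)) * (((m + 4 : ℕ) : ℝ) - k) := by
    rw [Finset.mul_sum]
    refine Finset.sum_congr rfl fun k _ => ?_
    rw [hxh]
    ring
  have hparts := sum_central_diff_mul_linear (fun t => t ^ (-α)) ((m + 4 : ℕ) : ℝ) m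
  simp only [Real.one_rpow] at hparts
  have hbracket : (1 - 2 * zr α) * x + ((2 : ℝ) ^ (-α) + 2 * zr α) * (x - h)
      + (∑ k ∈ Finset.Icc 2 (m + 2),
          (((k : ℝ) + 1) ^ (-α) - ((k : ℝ) - 1) ^ (-α)) * (x - (k : ℝ) * h))
      + (-((((m + 4 : ℕ) : ℝ) - 2) ^ (-α))) * (x - (((m + 4 : ℕ) : ℝ) - 1) * h)
      + (-((((m + 4 : ℕ) : ℝ) - 1) ^ (-α))) * (x - ((m + 4 : ℕ) : ℝ) * h)
      = 2 * h * ((∑ k ∈ Finset.Icc 1 (m + 3), (k : ℝ) ^ (-α)) - zr α) := by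
    rw [hsum, hparts, hxh]
    push_cast
    rw [show (m : ℝ) + 4 - 2 = m + 2 by ring]
    ring
  rw [hdiv, show m + 4 - 2 = m + 2 by omega, hbracket, hG, W, show m + 4 - 1 = m + 3 by omega,
    hxh, Real.mul_rpow hn0.le hh.le]
  generalize (∑ k ∈ Finset.Icc 1 (m + 3), (k : ℝ) ^ (-α)) = S
  have hlead : 1 / (2 * Real.Gamma (1 - α) * h ^ α) * (2 * h * (S - zr α))
      = h ^ (1 - α) / Real.Gamma (1 - α) * (S - zr α) := by
    rw [div_mul_eq_mul_div, div_mul_eq_mul_div, div_eq_div_iff (by positivity) hGpos.ne']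
    linear_combination (2 * (S - zr α) * Real.Gamma (1 - α)) * hpow
  rw [hlead]
  field_simp
  ring
end

section
/- Let 0 < α < 1. Then for every integer n ≥ 2, n^{1−α}/(1−α) − 1/(2n^α) − α/(12 n^{1+α}) < Σ_{k=1}^{n−1} k^{−α} − ζ(α) < n^{1−α}/(1−α) − 1/(2n^α). -/
open Filter Topology

lemma pos_of_hasDerivAt_pos {f f' : ℝ → ℝ} {a : ℝ} (hf : ∀ x, a ≤ x → HasDerivAt f (f' x) x)
    (ha : 0 ≤ f a) (hf' : ∀ x, a < x → 0 < f' x) {x : ℝ} (hx : a < x) : 0 < f x := by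
  have hmono : StrictMonoOn f (Set.Ici a) := by
    refine strictMonoOn_of_deriv_pos (convex_Ici a)
      (fun y hy => (hf y hy).continuousAt.continuousWithinAt) fun y hy => ?_
    rw [interior_Ici] at hy
    rw [(hf y (le_of_lt hy)).deriv]
    exact hf' y hy
  exact ha.trans_lt (hmono Set.self_mem_Ici hx.le hx)

lemma hasDerivAt_rpow_one_sub_div {α x : ℝ} (hα : α ≠ 1) (hx : 0 < x) :
    HasDerivAt (fun y : ℝ => y ^ (1 - α) / (1 - α)) (x ^ (-α)) x := by
  have h := (Real.hasDerivAt_rpow_const (p := 1 - α) (Or.inl hx.ne')).div_const (1 - α)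
  rwa [mul_div_cancel_left₀ _ (sub_ne_zero.2 hα.symm), show 1 - α - 1 = -α by ring] at h

/-- The trapezoid rule strictly overestimates the integral of `x ^ (-α)`. -/
lemma rpow_integral_lt_trapezoid {α a x : ℝ} (hα0 : 0 < α) (hα1 : α ≠ 1) (ha : 0 < a)
    (hx : a < x) :
    0 < (x - a) / 2 * (a ^ (-α) + x ^ (-α))
      - (x ^ (1 - α) / (1 - α) - a ^ (1 - α) / (1 - α)) := by
  have hd (r y : ℝ) (hy : a ≤ y) : HasDerivAt (fun y : ℝ => y ^ r) (r * y ^ (r - 1)) y :=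
    Real.hasDerivAt_rpow_const (Or.inl (ha.trans_le hy).ne')
  have hl (c y : ℝ) : HasDerivAt (fun y : ℝ => (y - a) / c) (1 / c) y :=
    ((hasDerivAt_id y).sub_const a).div_const c
  have h1 {y : ℝ} (hy : a < y) :
      0 < (a ^ (-α) - y ^ (-α)) / 2 + (y - a) / 2 * (-α * y ^ (-α - 1)) := by
    refine pos_of_hasDerivAt_pos (f := fun y : ℝ =>
        (a ^ (-α) - y ^ (-α)) / 2 + (y - a) / 2 * (-α * y ^ (-α - 1)))
      (f' := fun y => (y - a) / 2 * (α * (α + 1) * y ^ (-α - 1 - 1))) (fun y hy => ?_)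
      (by simp) (fun y hy => ?_) hy
    · convert! (((hd (-α) y hy).const_sub (a ^ (-α))).div_const 2).add
        ((hl 2 y).mul ((hd (-α - 1) y hy).const_mul (-α))) using 1
      ring
    · have := ha.trans hy
      have := sub_pos.2 hy
      positivity
  refine pos_of_hasDerivAt_pos (f := fun y : ℝ => (y - a) / 2 * (a ^ (-α) + y ^ (-α))
      - (y ^ (1 - α) / (1 - α) - a ^ (1 - α) / (1 - α))) (fun y hy => ?_)
    (by simp) (fun y hy => h1 hy) hx
  convert! ((hl 2 y).mul ((hd (-α) y hy).const_add (a ^ (-α)))).sub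
    ((hasDerivAt_rpow_one_sub_div hα1 (ha.trans_le hy)).sub_const _) using 1
  ring

/-- The endpoint-corrected trapezoid rule strictly underestimates the integral of `x ^ (-α)`. -/
lemma corrected_trapezoid_lt_rpow_integral {α a x : ℝ} (hα0 : 0 < α) (hα1 : α ≠ 1) (ha : 0 < a)
    (hx : a < x) :
    0 < (x - a) ^ 2 / 12 * (α * a ^ (-α - 1) - α * x ^ (-α - 1))
      - ((x - a) / 2 * (a ^ (-α) + x ^ (-α))
      - (x ^ (1 - α) / (1 - α) - a ^ (1 - α) / (1 - α))) := by
  have hd (r y : ℝ) (hy : a ≤ y) : HasDerivAt (fun y : ℝ => y ^ r) (r * y ^ (r - 1)) y :=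
    Real.hasDerivAt_rpow_const (Or.inl (ha.trans_le hy).ne')
  have hl (c y : ℝ) : HasDerivAt (fun y : ℝ => (y - a) / c) (1 / c) y :=
    ((hasDerivAt_id y).sub_const a).div_const c
  have hq (y : ℝ) : HasDerivAt (fun y : ℝ => (y - a) ^ 2 / 12) ((y - a) / 6) y := by
    convert! (((hasDerivAt_id y).sub_const a).pow 2).div_const 12 using 1
    simp
    ring
  have h2 {y : ℝ} (hy : a < y) :
      0 < (α * a ^ (-α - 1) - α * y ^ (-α - 1)) / 6
        - (y - a) / 6 * (α * (α + 1) * y ^ (-α - 1 - 1))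
        - (y - a) ^ 2 / 12 * (α * (α + 1) * (α + 2) * y ^ (-α - 1 - 1 - 1)) := by
    refine pos_of_hasDerivAt_pos (f := fun y : ℝ =>
        (α * a ^ (-α - 1) - α * y ^ (-α - 1)) / 6
        - (y - a) / 6 * (α * (α + 1) * y ^ (-α - 1 - 1))
        - (y - a) ^ 2 / 12 * (α * (α + 1) * (α + 2) * y ^ (-α - 1 - 1 - 1)))
      (f' := fun y => (y - a) ^ 2 / 12 *
        (α * (α + 1) * (α + 2) * (α + 3) * y ^ (-α - 1 - 1 - 1 - 1))) (fun y hy => ?_)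
      (by simp) (fun y hy => ?_) hy
    · convert! (((((hd (-α - 1) y hy).const_mul α).const_sub (α * a ^ (-α - 1))).div_const 6).sub
        ((hl 6 y).mul ((hd (-α - 1 - 1) y hy).const_mul (α * (α + 1))))).sub
        ((hq y).mul ((hd (-α - 1 - 1 - 1) y hy).const_mul (α * (α + 1) * (α + 2)))) using 1
      ring
    · have := ha.trans hy
      have := sub_pos.2 hy
      positivity
  have h1 {y : ℝ} (hy : a < y) :
      0 < (y - a) / 6 * (α * a ^ (-α - 1) - α * y ^ (-α - 1))
        + (y - a) ^ 2 / 12 * (α * (α + 1) * y ^ (-α - 1 - 1))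
        - ((a ^ (-α) - y ^ (-α)) / 2 + (y - a) / 2 * (-α * y ^ (-α - 1))) := by
    refine pos_of_hasDerivAt_pos (f := fun y : ℝ =>
        (y - a) / 6 * (α * a ^ (-α - 1) - α * y ^ (-α - 1))
        + (y - a) ^ 2 / 12 * (α * (α + 1) * y ^ (-α - 1 - 1))
        - ((a ^ (-α) - y ^ (-α)) / 2 + (y - a) / 2 * (-α * y ^ (-α - 1)))) (fun y hy => ?_)
      (by simp) (fun y hy => h2 hy) hy
    convert! (((hl 6 y).mul (((hd (-α - 1) y hy).const_mul α).const_sub (α * a ^ (-α - 1)))).add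
      ((hq y).mul ((hd (-α - 1 - 1) y hy).const_mul (α * (α + 1))))).sub
      ((((hd (-α) y hy).const_sub (a ^ (-α))).div_const 2).add
        ((hl 2 y).mul ((hd (-α - 1) y hy).const_mul (-α)))) using 1
    ring
  refine pos_of_hasDerivAt_pos (f := fun y : ℝ =>
      (y - a) ^ 2 / 12 * (α * a ^ (-α - 1) - α * y ^ (-α - 1))
      - ((y - a) / 2 * (a ^ (-α) + y ^ (-α))
      - (y ^ (1 - α) / (1 - α) - a ^ (1 - α) / (1 - α)))) (fun y hy => ?_)
    (by simp) (fun y hy => h1 hy) hx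
  convert! ((hq y).mul (((hd (-α - 1) y hy).const_mul α).const_sub (α * a ^ (-α - 1)))).sub
    (((hl 2 y).mul ((hd (-α) y hy).const_add (a ^ (-α)))).sub
    ((hasDerivAt_rpow_one_sub_div hα1 (ha.trans_le hy)).sub_const _)) using 1
  ring

/-- The differences `∫ (s - 1) * (n ^ (-s) - x ^ (-s))` over `[n, n + 1]`, with `n = k + 1`. -/
noncomputable def zetaIncrement (k : ℕ) (s : ℂ) : ℂ :=
  (s - 1) * ((k + 1 : ℕ) : ℂ) ^ (-s) + ((k + 2 : ℕ) : ℂ) ^ (1 - s) - ((k + 1 : ℕ) : ℂ) ^ (1 - s)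

lemma differentiable_zetaIncrement (k : ℕ) : Differentiable ℂ (zetaIncrement k) := by
  have h1 : ((k + 1 : ℕ) : ℂ) ≠ 0 := Nat.cast_ne_zero.2 (by lia)
  have h2 : ((k + 2 : ℕ) : ℂ) ≠ 0 := Nat.cast_ne_zero.2 (by lia)
  unfold zetaIncrement
  intro s
  refine .sub (.add (.mul (by fun_prop) ?_) ?_) ?_
  · exact .const_cpow (by fun_prop) (.inl h1)
  · exact .const_cpow (by fun_prop) (.inl h2)
  · exact .const_cpow (by fun_prop) (.inl h1)

lemma sum_zetaIncrement (n : ℕ) (s : ℂ) :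
    ∑ k ∈ Finset.range n, zetaIncrement k s =
      (s - 1) * ∑ k ∈ Finset.range n, ((k + 1 : ℕ) : ℂ) ^ (-s)
        + ((n + 1 : ℕ) : ℂ) ^ (1 - s) - 1 := by
  induction n with
  | zero => simp
  | succ n ih =>
    rw [Finset.sum_range_succ, Finset.sum_range_succ, ih, zetaIncrement]
    ring

lemma norm_cpow_neg_sub_le {a x : ℝ} (ha : 0 < a) (hx : a ≤ x) (hx' : x ≤ a + 1) {s : ℂ}
    (hs : 0 < s.re) :
    ‖(x : ℂ) ^ (-s) - (a : ℂ) ^ (-s)‖ ≤ ‖s‖ * a ^ (-s.re - 1) := by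
  have hs0 : -s ≠ 0 := neg_ne_zero.2 fun h => by simp [h] at hs
  have h := (convex_Icc a (a + 1)).norm_image_sub_le_of_norm_hasDerivWithin_le
    (f := fun y : ℝ => (y : ℂ) ^ (-s)) (f' := fun y : ℝ => -s * (y : ℂ) ^ (-s - 1))
    (C := ‖s‖ * a ^ (-s.re - 1)) (x := a) (y := x)
    (fun y hy => (hasDerivAt_ofReal_cpow_const (ha.trans_le hy.1).ne' hs0).hasDerivWithinAt)
    (fun y hy => ?_) ⟨le_rfl, by linarith⟩ ⟨hx, hx'⟩
  · refine h.trans (mul_le_of_le_one_right (by positivity) ?_)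
    rw [Real.norm_of_nonneg] <;> linarith
  · rw [norm_mul, norm_neg, Complex.norm_cpow_eq_rpow_re_of_pos (ha.trans_le hy.1)]
    gcongr
    simp only [Complex.sub_re, Complex.neg_re, Complex.one_re]
    exact Real.rpow_le_rpow_of_nonpos ha hy.1 (by linarith)

lemma norm_zetaIncrement_le (k : ℕ) {s : ℂ} (hs : 0 < s.re) :
    ‖zetaIncrement k s‖ ≤ ‖s - 1‖ * (‖s‖ * ((k + 1 : ℕ) : ℝ) ^ (-s.re - 1)) := by
  rcases eq_or_ne s 1 with rfl | hs1
  · simp [zetaIncrement]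
  set a : ℝ := ((k + 1 : ℕ) : ℝ) with ha_def
  have ha : 0 < a := by positivity
  have h := (convex_Icc a (a + 1)).norm_image_sub_le_of_norm_hasDerivWithin_le
    (f := fun y : ℝ => (y : ℂ) ^ (1 - s) - (1 - s) * (a : ℂ) ^ (-s) * y)
    (f' := fun y : ℝ => (1 - s) * ((y : ℂ) ^ (-s) - (a : ℂ) ^ (-s)))
    (C := ‖s - 1‖ * (‖s‖ * a ^ (-s.re - 1))) (x := a) (y := a + 1)
    (fun y hy => ?_) (fun y hy => ?_) ⟨le_rfl, by linarith⟩ ⟨by linarith, le_rfl⟩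
  · convert h using 1
    · congr 1
      simp only [zetaIncrement, ha_def]
      push_cast
      rw [show (k : ℂ) + 1 + 1 = k + 2 by ring]
      ring
    · simp
  · have h1 := hasDerivAt_ofReal_cpow_const (ha.trans_le hy.1).ne' (sub_ne_zero.2 hs1.symm)
    have h2 := (hasDerivAt_id y).ofReal_comp.const_mul ((1 - s) * (a : ℂ) ^ (-s))
    refine HasDerivAt.hasDerivWithinAt ?_
    convert! h1.sub h2 using 1
    rw [show 1 - s - 1 = -s by ring]
    simp
    ring
  · rw [norm_mul, norm_sub_rev 1 s]
    gcongr
    exact norm_cpow_neg_sub_le ha hy.1 hy.2 hs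

lemma norm_zetaIncrement_le_of_mem {ε : ℝ} (hε : 0 < ε) (k : ℕ) {s : ℂ} (hs : ε < s.re)
    (hs' : ‖s‖ < 3) :
    ‖zetaIncrement k s‖ ≤ 12 * ((k + 1 : ℕ) : ℝ) ^ (-ε - 1) := by
  refine (norm_zetaIncrement_le k (hε.trans hs)).trans ?_
  have h1 : ‖s - 1‖ ≤ 4 := (norm_sub_le _ _).trans (by simp; linarith)
  have h2 : ((k + 1 : ℕ) : ℝ) ^ (-s.re - 1) ≤ ((k + 1 : ℕ) : ℝ) ^ (-ε - 1) :=
    Real.rpow_le_rpow_of_exponent_le (by simp) (by linarith)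
  calc _ ≤ 4 * (3 * ((k + 1 : ℕ) : ℝ) ^ (-ε - 1)) := by gcongr
    _ = _ := by ring

lemma summable_zetaIncrement_bound {ε : ℝ} (hε : 0 < ε) :
    Summable fun k : ℕ => 12 * ((k + 1 : ℕ) : ℝ) ^ (-ε - 1) :=
  ((summable_nat_add_iff 1).2 (Real.summable_nat_rpow.2 (by linarith))).mul_left 12

lemma tsum_zetaIncrement_of_one_lt_re {s : ℂ} (hs : 1 < s.re) (hs' : ‖s‖ < 3) :
    ∑' k, zetaIncrement k s = riemannZeta₁ s - 1 := by
  have hs1 : s ≠ 1 := fun h => by simp [h] at hs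
  have hsum : Summable fun k => zetaIncrement k s :=
    .of_norm_bounded (summable_zetaIncrement_bound one_pos)
      fun k => norm_zetaIncrement_le_of_mem one_pos k hs hs'
  have hz : HasSum (fun k : ℕ => ((k + 1 : ℕ) : ℂ) ^ (-s)) (riemannZeta s) := by
    have h := (summable_nat_add_iff 1).2 (Complex.summable_one_div_nat_cpow.2 hs)
    rw [zeta_eq_tsum_one_div_nat_add_one_cpow hs]
    simpa [Complex.cpow_neg] using h.hasSum
  have h0 : Tendsto (fun n : ℕ => ((n + 1 : ℕ) : ℂ) ^ (1 - s)) atTop (𝓝 0) := by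
    rw [tendsto_zero_iff_norm_tendsto_zero]
    have h := (tendsto_rpow_neg_atTop (sub_pos.2 hs)).comp
      (tendsto_natCast_atTop_atTop.comp (tendsto_add_atTop_nat 1))
    refine h.congr fun n => ?_
    rw [Complex.norm_natCast_cpow_of_pos n.succ_pos]
    simp
  have hlim := (((hz.tendsto_sum_nat).const_mul (s - 1)).add h0).sub_const 1
  rw [← funext fun n => sum_zetaIncrement n s] at hlim
  rw [tendsto_nhds_unique hsum.hasSum.tendsto_sum_nat hlim, riemannZeta_eq_inv_sub_mul hs1,
    mul_inv_cancel_left₀ (sub_ne_zero.2 hs1), add_zero]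

lemma hasSum_zetaIncrement {s : ℂ} (hs : 0 < s.re) (hs' : ‖s‖ < 3) :
    HasSum (fun k => zetaIncrement k s) (riemannZeta₁ s - 1) := by
  obtain ⟨ε, hε, hεs⟩ : ∃ ε : ℝ, 0 < ε ∧ ε < min s.re 2 := exists_between (by simp [hs])
  rw [lt_min_iff] at hεs
  set U : Set ℂ := {z | ε < z.re} ∩ Metric.ball 0 3 with hU
  have hUo : IsOpen U := (isOpen_lt continuous_const Complex.continuous_re).inter Metric.isOpen_ball
  have hUc : IsPreconnected U :=
    ((convex_halfSpace_re_gt ε).inter (convex_ball 0 3)).isPreconnected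
  have hb (k : ℕ) (z : ℂ) (hz : z ∈ U) :
      ‖zetaIncrement k z‖ ≤ 12 * ((k + 1 : ℕ) : ℝ) ^ (-ε - 1) :=
    norm_zetaIncrement_le_of_mem hε k hz.1 (mem_ball_zero_iff.1 hz.2)
  have hd := Complex.differentiableOn_tsum_of_summable_norm (summable_zetaIncrement_bound hε)
    (fun k => (differentiable_zetaIncrement k).differentiableOn) hUo hb
  have hd' : DifferentiableOn ℂ (fun z => riemannZeta₁ z - 1) U :=
    (differentiable_riemannZeta₁.sub_const 1).differentiableOn
  have hev : (fun z => ∑' k, zetaIncrement k z) =ᶠ[𝓝 2] fun z => riemannZeta₁ z - 1 := by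
    have h1 : ∀ᶠ z : ℂ in 𝓝 2, 1 < z.re :=
      (isOpen_lt continuous_const Complex.continuous_re).mem_nhds (by simp)
    have h2 : ∀ᶠ z : ℂ in 𝓝 2, ‖z‖ < 3 :=
      (isOpen_lt continuous_norm continuous_const).mem_nhds (by norm_num)
    filter_upwards [h1, h2] with z hz hz' using tsum_zetaIncrement_of_one_lt_re hz hz'
  have heq := (hd.analyticOnNhd hUo).eqOn_of_preconnected_of_eventuallyEq
    (hd'.analyticOnNhd hUo) hUc (z₀ := 2) ⟨by simpa using hεs.2, by norm_num⟩ hev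
  have hsU : s ∈ U := ⟨hεs.1, mem_ball_zero_iff.2 hs'⟩
  rw [← show ∑' k, zetaIncrement k s = riemannZeta₁ s - 1 from heq hsU]
  exact (Summable.of_norm_bounded (summable_zetaIncrement_bound hε) fun k => hb k s hsU).hasSum

lemma tendsto_partial_sum_sub_rpow {α : ℝ} (hα0 : 0 < α) (hα1 : α < 1) :
    Tendsto (fun n : ℕ => ∑ k ∈ Finset.range n, ((k + 1 : ℕ) : ℝ) ^ (-α)
      - ((n + 1 : ℕ) : ℝ) ^ (1 - α) / (1 - α)) atTop (𝓝 (zr α)) := by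
  have hne : (α : ℂ) ≠ 1 := by exact_mod_cast hα1.ne
  have h := (hasSum_zetaIncrement (s := α) (by simpa) (by
    rw [Complex.norm_real, Real.norm_of_nonneg hα0.le]; linarith)).tendsto_sum_nat
  have h' := ((h.add_const 1).const_mul ((α : ℂ) - 1)⁻¹)
  rw [sub_add_cancel, ← riemannZeta_eq_inv_sub_mul hne] at h'
  refine ((Complex.continuous_re.tendsto _).comp h').congr fun n => ?_
  have hα' : (α : ℂ) - 1 ≠ 0 := sub_ne_zero.2 hne
  have hα'' : (1 : ℂ) - α ≠ 0 := sub_ne_zero.2 hne.symm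
  rw [Function.comp_apply, ← Complex.ofReal_re (_ - _)]
  congr 1
  rw [sum_zetaIncrement]
  push_cast [Complex.ofReal_cpow (Nat.cast_nonneg _)]
  rw [Complex.ofReal_cpow (by positivity)]
  have hsum : (∑ k ∈ Finset.range n, ((((k : ℝ) + 1) ^ (-α) : ℝ) : ℂ))
      = ∑ k ∈ Finset.range n, ((k : ℂ) + 1) ^ (-(α : ℂ)) :=
    Finset.sum_congr rfl fun k _ => by
      rw [Complex.ofReal_cpow (by positivity)]; push_cast; rfl
  rw [hsum]
  push_cast
  field_simp
  ring

theorem partial_sum_zeta_estimates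
    (α : ℝ) (hα0 : 0 < α) (hα1 : α < 1) :
    ∀ n : ℕ, 2 ≤ n →
      (n:ℝ) ^ (1 - α) / (1 - α) - 1 / (2 * (n:ℝ) ^ α) - α / (12 * (n:ℝ) ^ (1 + α))
          < (∑ k ∈ Finset.Icc 1 (n - 1), (k:ℝ) ^ (-α)) - zr α ∧
      (∑ k ∈ Finset.Icc 1 (n - 1), (k:ℝ) ^ (-α)) - zr α
          < (n:ℝ) ^ (1 - α) / (1 - α) - 1 / (2 * (n:ℝ) ^ α) := by
  set S : ℕ → ℝ := fun m => ∑ k ∈ Finset.range m, ((k + 1 : ℕ) : ℝ) ^ (-α)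
    - ((m + 1 : ℕ) : ℝ) ^ (1 - α) / (1 - α) with hS
  have hlim0 (r : ℝ) (hr : 0 < r) :
      Tendsto (fun m : ℕ => ((m + 1 : ℕ) : ℝ) ^ (-r)) atTop (𝓝 0) :=
    (tendsto_rpow_neg_atTop hr).comp
      (tendsto_natCast_atTop_atTop.comp (tendsto_add_atTop_nat 1))
  have hSlim : Tendsto S atTop (𝓝 (zr α)) := tendsto_partial_sum_sub_rpow hα0 hα1
  have hulim : Tendsto (fun m => S m + ((m + 1 : ℕ) : ℝ) ^ (-α) / 2) atTop (𝓝 (zr α)) := by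
    simpa using hSlim.add ((hlim0 α hα0).div_const 2)
  have hvlim : Tendsto (fun m => S m + ((m + 1 : ℕ) : ℝ) ^ (-α) / 2
      + α * ((m + 1 : ℕ) : ℝ) ^ (-α - 1) / 12) atTop (𝓝 (zr α)) := by
    have h := (((hlim0 (1 + α) (by linarith)).const_mul α).div_const 12)
    rw [show -(1 + α) = -α - 1 by ring] at h
    simpa using hulim.add h
  have hstep (m : ℕ) : S (m + 1) = S m + ((m + 1 : ℕ) : ℝ) ^ (-α)
      - (((m + 1 + 1 : ℕ) : ℝ) ^ (1 - α) / (1 - α) - ((m + 1 : ℕ) : ℝ) ^ (1 - α) / (1 - α)) := by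
    simp only [hS, Finset.sum_range_succ]
    ring
  have hsub (m : ℕ) : ((m + 1 + 1 : ℕ) : ℝ) - ((m + 1 : ℕ) : ℝ) = 1 := by push_cast; ring
  have hu : StrictMono fun m => S m + ((m + 1 : ℕ) : ℝ) ^ (-α) / 2 := by
    refine strictMono_nat_of_lt_succ fun m => ?_
    have h := rpow_integral_lt_trapezoid (a := ((m + 1 : ℕ) : ℝ)) (x := ((m + 1 + 1 : ℕ) : ℝ))
      hα0 hα1.ne (by positivity) (by simp)
    rw [hsub] at h
    simp only [hstep]
    linarith
  have hv : StrictAnti fun m => S m + ((m + 1 : ℕ) : ℝ) ^ (-α) / 2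
      + α * ((m + 1 : ℕ) : ℝ) ^ (-α - 1) / 12 := by
    refine strictAnti_nat_of_succ_lt fun m => ?_
    have h := corrected_trapezoid_lt_rpow_integral (a := ((m + 1 : ℕ) : ℝ))
      (x := ((m + 1 + 1 : ℕ) : ℝ)) hα0 hα1.ne (by positivity) (by simp)
    rw [hsub] at h
    simp only [hstep]
    linarith
  intro n hn
  obtain ⟨m, rfl⟩ : ∃ m, n = m + 1 := ⟨n - 1, by lia⟩
  have hpos : (0 : ℝ) < ((m + 1 : ℕ) : ℝ) := by positivity
  have hsum : ∑ k ∈ Finset.Icc 1 (m + 1 - 1), (k : ℝ) ^ (-α)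
      = ∑ k ∈ Finset.range m, ((k + 1 : ℕ) : ℝ) ^ (-α) := by
    rw [Finset.range_eq_Ico, Finset.sum_Ico_add' (fun k : ℕ => (k : ℝ) ^ (-α)) 0 m 1]
    rfl
  have e1 : 1 / (2 * ((m + 1 : ℕ) : ℝ) ^ α) = ((m + 1 : ℕ) : ℝ) ^ (-α) / 2 := by
    rw [Real.rpow_neg hpos.le]
    field_simp
  have e2 : α / (12 * ((m + 1 : ℕ) : ℝ) ^ (1 + α)) = α * ((m + 1 : ℕ) : ℝ) ^ (-α - 1) / 12 := by
    rw [show -α - 1 = -(1 + α) by ring, Real.rpow_neg hpos.le]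
    field_simp
  rw [hsum, e1, e2]
  have h1 := (hu m.lt_succ_self).trans_le (hu.monotone.ge_of_tendsto hulim (m + 1))
  have h2 := (hv.antitone.le_of_tendsto hvlim (m + 1)).trans_lt (hv m.lt_succ_self)
  simp only [hS] at h1 h2
  constructor <;> linarith
end
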